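/- arXiv:2403.10189 — 2 statements merged into one kernel-verified Lean document; each statement's English description precedes it below -/
import Mathlib

section
/- For every nonnegative integer n, the number of partitions of n into parts each at least 1, with no two parts equal or consecutive, and with no two even parts equal or consecutive, equals the number of partitions of n into parts congruent to 1, 4, or 7 modulo 8. -/
/-- Odd parts are pairwise distinct. -/
def distinctOddParts (m : Multiset ℕ) : Prop := ∀ a, Odd a → m.count a ≤ 1

/-- Every even part is at least `k` (vacuous if no even part). -/
def minEvenGe (m : Multiset ℕ) (k : ℕ) : Prop := ∀ a ∈ m, Even a → k ≤ a

/-- Every odd part is at least `k` (vacuous if no odd part). -/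
def minOddGe (m : Multiset ℕ) (k : ℕ) : Prop := ∀ a ∈ m, Odd a → k ≤ a

/-- No two parts are equal or consecutive, and no two even parts are equal or
consecutive even numbers: parts pairwise differ by at least 2, even parts by at least 4. -/
def gapCond (m : Multiset ℕ) : Prop :=
  (∀ a, m.count a ≤ 1) ∧ (∀ a ∈ m, ∀ b ∈ m, a < b → a + 2 ≤ b) ∧
  (∀ a ∈ m, ∀ b ∈ m, Even a → Even b → a < b → a + 4 ≤ b)

/-- Number of even parts. -/
def evenCount (m : Multiset ℕ) : ℕ := (m.filter (fun a => Even a)).card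

/-- Number of odd parts. -/
def oddCount (m : Multiset ℕ) : ℕ := (m.filter (fun a => Odd a)).card

namespace GoellnitzGordon
open Finset

variable {A : Type*} [CommRing A]

/-- The summands of a series solution, for `k : ℕ`, of the recurrence
`K k = (1 + x ^ (2 * k + 1)) * K (k + 1) + x ^ (2 * k + 2) * K (k + 2)`. -/
def summand (x : A) (E : ℕ → A) (k r : ℕ) : A :=
  (-1) ^ r * (∏ i ∈ range k, (1 - x ^ (2 * (r + 1 + i)))) *
    (∏ i ∈ range r, (1 + x ^ (2 * i + 1))) * E (k + r + 1) * x ^ (4 * k * r + 4 * r ^ 2 + r) *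
    ((1 + x ^ (2 * k + 2 * r + 1)) - (1 + x ^ (2 * r + 1)) * x ^ (4 * k + 6 * r + 3))

/-- The telescoping certificate for the recurrence satisfied by the sums of `summand`. -/
def certificate (x : A) (E : ℕ → A) (k r : ℕ) : A :=
  (-1) ^ r * (∏ i ∈ range (k + 1), (1 - x ^ (2 * (r + i)))) *
    (∏ i ∈ range r, (1 + x ^ (2 * i + 1))) * E (k + r + 2) * x ^ (4 * k * r + 4 * r ^ 2 + r) *
    (x ^ (4 * k + 8 * r + 4) - x ^ (2 * k + 6 * r + 2)
      - x ^ (2 * k + 4 * r + 3) * (1 + x ^ (2 * k + 1))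
      - x ^ (2 * r) * (1 + x ^ (2 * k + 1) + x ^ (2 * k + 3)) - 1)

theorem summand_sub_eq_certificate_sub (x : A) (E : ℕ → A)
    (hE : ∀ m, E m = (1 + x ^ (2 * m + 1)) * E (m + 1)) (k r : ℕ) :
    summand x E k r - (1 + x ^ (2 * k + 1)) * summand x E (k + 1) r
        - x ^ (2 * k + 2) * summand x E (k + 2) r =
      certificate x E k (r + 1) - certificate x E k r := by
  have h1 : E (k + r + 1) = (1 + x ^ (2 * (k + r + 1) + 1)) *
      ((1 + x ^ (2 * (k + r + 2) + 1)) * E (k + r + 3)) := by rw [hE, hE (k + r + 2)]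
  have h2 : E (k + 1 + r + 1) = (1 + x ^ (2 * (k + r + 2) + 1)) * E (k + r + 3) := by
    rw [← hE]; congr 1; ring
  have h3 : E (k + 2 + r + 1) = E (k + r + 3) := by congr 1; ring
  have h4 : E (k + (r + 1) + 2) = E (k + r + 3) := by congr 1
  have h5 : E (k + r + 2) = (1 + x ^ (2 * (k + r + 2) + 1)) * E (k + r + 3) := hE _
  have hP : ∏ i ∈ range (k + 1), (1 - x ^ (2 * (r + i))) =
      (∏ i ∈ range k, (1 - x ^ (2 * (r + 1 + i)))) * (1 - x ^ (2 * r)) := by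
    rw [prod_range_succ']
    simp only [add_zero, add_assoc, add_comm 1]
  unfold summand certificate
  rw [h1, h2, h3, h4, h5, hP]
  simp only [prod_range_succ, pow_succ (-1 : A)]
  generalize (∏ i ∈ range k, (1 - x ^ (2 * (r + 1 + i)))) = P
  generalize (∏ i ∈ range r, (1 + x ^ (2 * i + 1))) = O
  generalize E (k + r + 3) = e
  generalize (-1 : A) ^ r = σ
  ring

/-- Partial sums of the series agree with a solution of the recurrence, up to a vanishing power. -/
theorem sum_summand_recurrence {x : A} {N : ℕ} (hx : x ^ N = 0) (E : ℕ → A)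
    (hE : ∀ m, E m = (1 + x ^ (2 * m + 1)) * E (m + 1)) (k : ℕ) :
    ∑ r ∈ range N, summand x E k r =
      (1 + x ^ (2 * k + 1)) * ∑ r ∈ range N, summand x E (k + 1) r +
        x ^ (2 * k + 2) * ∑ r ∈ range N, summand x E (k + 2) r := by
  have h := sum_range_sub (certificate x E k) N
  simp only [← summand_sub_eq_certificate_sub x E hE, sum_sub_distrib, ← mul_sum] at h
  have h0 : certificate x E k 0 = 0 := by simp [certificate, prod_range_succ']
  have hN : certificate x E k N = 0 := by
    have : x ^ (4 * k * N + 4 * N ^ 2 + N) = 0 := by rw [pow_add, hx, mul_zero]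
    simp [certificate, this]
  rw [h0, hN] at h
  linear_combination h

theorem prod_eq_of_pow_eq_zero {x : A} {N : ℕ} (hx : x ^ N = 0) (c : A) (f : ℕ → ℕ)
    (hf : ∀ i, i ≤ f i) {m : ℕ} (hm : N ≤ m) :
    ∏ i ∈ range m, (1 + c * x ^ f i) = ∏ i ∈ range N, (1 + c * x ^ f i) := by
  refine (prod_subset (range_subset_range.2 hm) fun i _ hi ↦ ?_).symm
  rw [pow_eq_zero_of_le (le_trans (by simpa using hi) (hf i)) hx, mul_zero, add_zero]

theorem recurrence_mul_prod {x : A} {N : ℕ} (hx : x ^ N = 0) (F : ℕ → A)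
    (hF : ∀ k < N, F k = (1 + x ^ (2 * k + 1)) * F (k + 1) + x ^ (2 * k + 2) * F (k + 2))
    (hF1 : ∀ k, N ≤ k → F k = 1) :
    F 0 * ∏ i ∈ range N, (1 - x ^ (2 * i + 2)) =
      (∏ i ∈ range N, (1 + x ^ (2 * i + 1))) *
        ∑ r ∈ range N, (-1) ^ r * x ^ (4 * r ^ 2 + r) * (1 - x ^ (6 * r + 3)) := by
  have hx' : ∀ m, N ≤ m → x ^ m = 0 := fun m hm ↦ pow_eq_zero_of_le hm hx
  set E : ℕ → A := fun m ↦ ∏ i ∈ range N, (1 + x ^ (2 * (m + i) + 1)) with hEdef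
  have hE : ∀ m, E m = (1 + x ^ (2 * m + 1)) * E (m + 1) := fun m ↦ by
    have h1 := prod_range_succ (fun i ↦ 1 + x ^ (2 * (m + i) + 1)) N
    rw [prod_range_succ', hx' (2 * (m + N) + 1) (by omega), add_zero, add_zero, mul_one] at h1
    simp only [hEdef, ← h1, mul_comm (1 + x ^ (2 * m + 1)), add_comm 1, add_assoc]
  have hE1 : ∀ m, N ≤ m → E m = 1 := fun m hm ↦
    prod_eq_one fun i _ ↦ by rw [hx' _ (by omega), add_zero]
  have key : ∀ j k, N ≤ k + j → F k * ∏ i ∈ range N, (1 - x ^ (2 * i + 2)) =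
      ∑ r ∈ range N, summand x E k r := by
    intro j
    induction j using Nat.strong_induction_on with
    | _ j ih =>
      intro k hk
      rcases lt_or_ge k N with hkN | hkN
      · rw [hF k hkN, sum_summand_recurrence hx E hE k,
          ← ih (j - 1) (by omega) (k + 1) (by omega), ← ih (j - 2) (by omega) (k + 2) (by omega)]
        ring
      · rw [hF1 k hkN, one_mul]
        rcases Nat.eq_zero_or_pos N with rfl | hN
        · have : Subsingleton A := subsingleton_of_zero_eq_one (by simpa using hx.symm)
          exact Subsingleton.elim _ _
        rw [sum_eq_single_of_mem 0 (by simpa using hN) fun r _ hr ↦ by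
          have : k ≤ k * r := Nat.le_mul_of_pos_right _ (by omega)
          simp [summand, hx' (4 * k * r + 4 * r ^ 2 + r) (by nlinarith)]]
        have h := prod_eq_of_pow_eq_zero hx (-1) (fun i ↦ 2 * i + 2) (by omega) hkN
        simp only [neg_one_mul, ← sub_eq_add_neg] at h
        rw [← h]
        have h2 : ∏ i ∈ range k, (1 - x ^ (2 * i + 2)) =
            ∏ i ∈ range k, (1 - x ^ (2 * (0 + 1 + i))) :=
          prod_congr rfl fun i _ ↦ by ring
        simp only [summand, h2, mul_zero, add_zero, hE1 (k + 1) (by omega),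
          hx' (2 * k + 1) (by omega), hx' (4 * k + 3) (by omega)]
        simp
  have hO : ∀ r, E 0 = (∏ i ∈ range r, (1 + x ^ (2 * i + 1))) * E r := fun r ↦ by
    induction r with
    | zero => simp
    | succ r ih => rw [ih, prod_range_succ, hE r]; ring
  rw [key N 0 (by omega), mul_sum]
  refine sum_congr rfl fun r _ ↦ ?_
  have h0 : ∏ i ∈ range N, (1 + x ^ (2 * i + 1)) = E 0 := by simp only [hEdef, zero_add]
  rw [h0, hO r, hE r]
  simp only [summand, range_zero, prod_empty, mul_zero, zero_add, zero_mul]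
  ring
theorem isUnit_prod_one_sub_pow {x : A} {N : ℕ} (hx : x ^ N = 0) (s : Finset ℕ) (f : ℕ → ℕ)
    (hf : ∀ i ∈ s, f i ≠ 0) : IsUnit (∏ i ∈ s, (1 - x ^ f i)) :=
  IsUnit.prod_iff.2 fun i hi ↦ (IsNilpotent.pow_of_pos ⟨N, hx⟩ (hf i hi)).isUnit_one_sub

/-- The Gaussian binomial coefficients, evaluated at `q`. -/
def gaussBinom (q : A) : ℕ → ℕ → A
  | _, 0 => 1
  | 0, _ + 1 => 0
  | m + 1, i + 1 => gaussBinom q m i + q ^ (i + 1) * gaussBinom q m (i + 1)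

@[simp] theorem gaussBinom_zero_right (q : A) (m : ℕ) : gaussBinom q m 0 = 1 := by
  cases m <;> rfl

theorem gaussBinom_succ_succ (q : A) (m i : ℕ) : gaussBinom q (m + 1) (i + 1) =
    gaussBinom q m i + q ^ (i + 1) * gaussBinom q m (i + 1) := rfl

theorem gaussBinom_eq_zero_of_lt (q : A) {m i : ℕ} (h : m < i) : gaussBinom q m i = 0 := by
  induction m generalizing i with
  | zero => obtain ⟨i, rfl⟩ := Nat.exists_eq_add_one_of_ne_zero (by omega : i ≠ 0); rfl
  | succ m ih =>
    obtain ⟨i, rfl⟩ := Nat.exists_eq_add_one_of_ne_zero (by omega : i ≠ 0)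
    rw [gaussBinom_succ_succ, ih (by omega), ih (by omega), mul_zero, add_zero]

theorem gaussBinom_self (q : A) (m : ℕ) : gaussBinom q m m = 1 := by
  induction m with
  | zero => rfl
  | succ m ih =>
    rw [gaussBinom_succ_succ, ih, gaussBinom_eq_zero_of_lt q (by omega), mul_zero, add_zero]

theorem map_gaussBinom {B : Type*} [CommRing B] (φ : A →+* B) (q : A) (m i : ℕ) :
    φ (gaussBinom q m i) = gaussBinom (φ q) m i := by
  induction m generalizing i with
  | zero => cases i <;> simp [gaussBinom]
  | succ m ih => cases i <;> simp [gaussBinom_succ_succ, ih]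

theorem gaussBinom_mul_prod_mul_prod (q : A) (i j : ℕ) :
    gaussBinom q (i + j) i * (∏ l ∈ range i, (1 - q ^ (l + 1))) *
      (∏ l ∈ range j, (1 - q ^ (l + 1))) = ∏ l ∈ range (i + j), (1 - q ^ (l + 1)) := by
  induction i generalizing j with
  | zero => simp
  | succ i ihi =>
    induction j with
    | zero => simp [gaussBinom_self]
    | succ j ihj =>
      have h1 := ihi (j + 1)
      rw [show i + 1 + (j + 1) = (i + (j + 1)) + 1 by ring, gaussBinom_succ_succ,
        prod_range_succ _ (i + (j + 1)), ← h1]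
      rw [show i + 1 + j = i + (j + 1) by ring, ← h1] at ihj
      simp only [prod_range_succ] at ihj ⊢
      linear_combination q ^ (i + 1) * (1 - q ^ (j + 1)) * ihj

/-- The `q`-binomial theorem. -/
theorem prod_add_mul_pow (q a b : A) (m : ℕ) :
    ∏ j ∈ range m, (a + b * q ^ j) =
      ∑ i ∈ range (m + 1), gaussBinom q m i * q ^ (i.choose 2) * a ^ (m - i) * b ^ i := by
  induction m generalizing b with
  | zero => simp
  | succ m ih =>
    rw [prod_range_succ', sum_range_succ']
    have h1 : ∏ k ∈ range m, (a + b * q ^ (k + 1)) = ∏ k ∈ range m, (a + b * q * q ^ k) :=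
      prod_congr rfl fun k _ ↦ by ring
    have h2 : ∀ i ∈ range (m + 1), gaussBinom q (m + 1) (i + 1) * q ^ ((i + 1).choose 2) *
          a ^ (m + 1 - (i + 1)) * b ^ (i + 1) =
        b * (gaussBinom q m i * q ^ (i.choose 2) * a ^ (m - i) * (b * q) ^ i) +
        a * (gaussBinom q m (i + 1) * q ^ ((i + 1).choose 2) * a ^ (m - (i + 1)) *
          (b * q) ^ (i + 1)) := fun i hi ↦ by
      rw [gaussBinom_succ_succ, Nat.add_sub_add_right, Nat.choose_succ_succ' i 1,
        Nat.choose_one_right]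
      rcases (Nat.le_of_lt_succ (mem_range.1 hi)).eq_or_lt with rfl | h
      · rw [gaussBinom_eq_zero_of_lt q (by omega : i < i + 1)]; ring
      · rw [show m - i = m - (i + 1) + 1 by omega]; ring
    rw [sum_congr rfl h2, sum_add_distrib, ← mul_sum, ← mul_sum, h1, ih]
    have h3 := sum_range_succ' (fun i ↦ gaussBinom q m i * q ^ (i.choose 2) * a ^ (m - i) *
      (b * q) ^ i) (m + 1)
    rw [sum_range_succ, gaussBinom_eq_zero_of_lt q (by omega : m < m + 1)] at h3
    simp only [gaussBinom_zero_right, Nat.sub_zero, Nat.choose_zero_succ, pow_zero, mul_one,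
      one_mul, zero_mul, add_zero, pow_succ] at h3 ⊢
    linear_combination a * h3

/-- A finite form of the instance `q ↦ x ^ 8`, `z ↦ x ^ 3` of Jacobi's triple product. -/
theorem finite_triple_product (x : A) (n : ℕ) :
    ∏ l ∈ range n, ((1 - x ^ (8 * l + 3)) * (1 - x ^ (8 * l + 5))) =
      ∑ r ∈ range (n + 1), (-1) ^ r * gaussBinom (x ^ 8) (2 * n) (n - r) * x ^ (4 * r ^ 2 + r) -
      ∑ r ∈ range n, (-1) ^ r * gaussBinom (x ^ 8) (2 * n) (n + 1 + r) *
        x ^ (4 * r ^ 2 + 7 * r + 3) := by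
  suffices h : ∏ l ∈ range n, ((1 - (.X : Polynomial ℤ) ^ (8 * l + 3)) * (1 - .X ^ (8 * l + 5))) =
      ∑ r ∈ range (n + 1), (-1) ^ r * gaussBinom (.X ^ 8) (2 * n) (n - r) * .X ^ (4 * r ^ 2 + r) -
      ∑ r ∈ range n, (-1) ^ r * gaussBinom (.X ^ 8) (2 * n) (n + 1 + r) *
        .X ^ (4 * r ^ 2 + 7 * r + 3) by
    have hφ : Polynomial.eval₂RingHom (Int.castRingHom A) x .X = x := by simp
    simpa only [map_sub, map_sum, map_prod, map_mul, map_pow, map_one, map_neg, map_gaussBinom, hφ]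
      using congrArg (Polynomial.eval₂RingHom (Int.castRingHom A) x) h
  rcases Nat.eq_zero_or_pos n with rfl | hn
  · simp
  generalize hX : (Polynomial.X : Polynomial ℤ) = X
  have hX0 : X ≠ 0 := hX ▸ Polynomial.X_ne_zero
  have key := prod_add_mul_pow (X ^ 8) (-X ^ (8 * n - 3)) 1 (2 * n)
  rw [show 2 * n + 1 = n + 1 + n by ring, sum_range_add, ← sum_range_reflect,
    show 2 * n = n + n by ring, prod_range_add, ← prod_range_reflect, ← two_mul] at key
  have hch : ∀ i : ℕ, 8 * i.choose 2 + 4 * i = 4 * i ^ 2 := fun i ↦ by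
    induction i with
    | zero => rfl
    | succ i ih =>
      rw [Nat.choose_succ_succ' i 1, Nat.choose_one_right]
      linarith
  have e1 : ∀ j ∈ range n, (-X ^ (8 * n - 3) + 1 * (X ^ 8) ^ (n - 1 - j)) =
      X ^ (8 * (n - 1 - j)) * (1 - X ^ (8 * j + 5)) := fun j hj ↦ by
    rw [mem_range] at hj
    rw [← pow_mul, mul_sub, ← pow_add]
    rw [show 8 * (n - 1 - j) + (8 * j + 5) = 8 * n - 3 by omega]
    ring
  have e2 : ∀ j ∈ range n, (-X ^ (8 * n - 3) + 1 * (X ^ 8) ^ (n + j)) =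
      -X ^ (8 * n - 3) * (1 - X ^ (8 * j + 3)) := fun j hj ↦ by
    have : X ^ (8 * (n + j)) = X ^ (8 * n - 3) * X ^ (8 * j + 3) := by
      rw [← pow_add, show 8 * n - 3 + (8 * j + 3) = 8 * (n + j) by omega]
    rw [← pow_mul, this]
    ring
  have e3 : ∏ j ∈ range n, X ^ (8 * (n - 1 - j)) = X ^ (8 * n.choose 2) := by
    rw [prod_pow_eq_pow_sum, ← mul_sum, sum_range_reflect (fun j ↦ j), sum_range_id,
      Nat.choose_two_right]
  have e4 : ∀ r ∈ range (n + 1), gaussBinom (X ^ 8) (2 * n) (n + 1 - 1 - r) *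
      (X ^ 8) ^ (n + 1 - 1 - r).choose 2 * (-X ^ (8 * n - 3)) ^ (2 * n - (n + 1 - 1 - r)) *
        1 ^ (n + 1 - 1 - r) = (X ^ (8 * n.choose 2) * (-X ^ (8 * n - 3)) ^ n) *
      ((-1) ^ r * gaussBinom (X ^ 8) (2 * n) (n - r) * X ^ (4 * r ^ 2 + r)) := fun r hr ↦ by
    obtain ⟨s, rfl⟩ := Nat.exists_eq_add_of_le (Nat.le_of_lt_succ (mem_range.1 hr))
    have h : 8 * s.choose 2 + (8 * (r + s) - 3) * r = 8 * (r + s).choose 2 + (4 * r ^ 2 + r) := by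
      have h1 := hch s
      have h2 := hch (r + s)
      zify [show 3 ≤ 8 * (r + s) by omega] at h1 h2 ⊢
      linear_combination h1 - h2
    rw [show r + s + 1 - 1 - r = s by omega, show r + s - r = s by omega,
      show 2 * (r + s) - s = (r + s) + r by omega, one_pow, pow_add (-X ^ (8 * (r + s) - 3)),
      neg_pow (X ^ (8 * (r + s) - 3)) r, ← pow_mul, ← pow_mul]
    have h' : X ^ (8 * s.choose 2) * X ^ ((8 * (r + s) - 3) * r) =
        X ^ (8 * (r + s).choose 2) * X ^ (4 * r ^ 2 + r) := by rw [← pow_add, ← pow_add, h]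
    linear_combination gaussBinom (X ^ 8) (2 * (r + s)) s * (-X ^ (8 * (r + s) - 3)) ^ (r + s) *
      (-1) ^ r * h'
  have e5 : ∀ r ∈ range n, gaussBinom (X ^ 8) (2 * n) (n + 1 + r) *
      (X ^ 8) ^ (n + 1 + r).choose 2 * (-X ^ (8 * n - 3)) ^ (2 * n - (n + 1 + r)) *
        1 ^ (n + 1 + r) = (X ^ (8 * n.choose 2) * (-X ^ (8 * n - 3)) ^ n) *
      -((-1) ^ r * gaussBinom (X ^ 8) (2 * n) (n + 1 + r) * X ^ (4 * r ^ 2 + 7 * r + 3)) := by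
    intro r hr
    obtain ⟨s, rfl⟩ := Nat.exists_eq_add_of_le (Nat.succ_le_of_lt (mem_range.1 hr))
    generalize hm : r.succ + s = m
    have h : 8 * (m + 1 + r).choose 2 =
        8 * m.choose 2 + (8 * m - 3) * (r + 1) + (4 * r ^ 2 + 7 * r + 3) := by
      have h1 := hch m
      have h2 := hch (m + 1 + r)
      zify [show 3 ≤ 8 * m by omega] at h1 h2 ⊢
      linear_combination h2 - h1
    rw [show 2 * m - (m + 1 + r) = s by omega, one_pow, ← pow_mul, h,
      show (-X ^ (8 * m - 3)) ^ m = (-X ^ (8 * m - 3)) ^ s * ((-1) ^ (r + 1) *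
        X ^ ((8 * m - 3) * (r + 1))) by
          rw [pow_mul, ← neg_pow, ← pow_add, show s + (r + 1) = m by omega]]
    have h1 : ((-1 : Polynomial ℤ) ^ r) ^ 2 = 1 := by rw [← pow_mul, mul_comm, pow_mul]; simp
    generalize (-X ^ (8 * m - 3)) ^ s = Z
    simp only [pow_add X, pow_succ (-1 : Polynomial ℤ) r]
    linear_combination (-h1) * gaussBinom (X ^ 8) (2 * m) (m + 1 + r) * X ^ (8 * m.choose 2) *
      X ^ ((8 * m - 3) * (r + 1)) * X ^ (4 * r ^ 2) * X ^ (7 * r) * X ^ 3 * Z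
  rw [prod_congr rfl e1, prod_congr rfl e2, sum_congr rfl e4, sum_congr rfl e5, ← mul_sum,
    ← mul_sum, prod_mul_distrib, prod_mul_distrib, e3, prod_const, card_range, sum_neg_distrib,
    ← mul_add, ← sub_eq_add_neg] at key
  refine mul_left_cancel₀ (mul_ne_zero (pow_ne_zero _ hX0) (pow_ne_zero n
    (neg_ne_zero.2 (pow_ne_zero (8 * n - 3) hX0)))) (Eq.trans ?_ key)
  rw [prod_mul_distrib]
  ring

theorem triple_product_of_pow_eq_zero {x : A} {N : ℕ} (hx : x ^ N = 0) :
    ∑ r ∈ range N, (-1) ^ r * x ^ (4 * r ^ 2 + r) * (1 - x ^ (6 * r + 3)) =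
      (∏ i ∈ range N, (1 - x ^ (8 * i + 3))) * (∏ i ∈ range N, (1 - x ^ (8 * i + 5))) *
        ∏ i ∈ range N, (1 - x ^ (8 * i + 8)) := by
  have hx' : ∀ m, N ≤ m → x ^ m = 0 := fun m hm ↦ pow_eq_zero_of_le hm hx
  have hprod : ∀ c m, N ≤ m →
      ∏ i ∈ range m, (1 - x ^ (8 * i + c)) = ∏ i ∈ range N, (1 - x ^ (8 * i + c)) := by
    intro c m hm
    simpa only [neg_one_mul, ← sub_eq_add_neg] using
      prod_eq_of_pow_eq_zero hx (-1) (fun i ↦ 8 * i + c) (by omega) hm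
  have hu := isUnit_prod_one_sub_pow hx (range N) (fun i ↦ 8 * i + 8) (by omega)
  have hg : ∀ i j, N ≤ i → N ≤ j →
      gaussBinom (x ^ 8) (i + j) i * ∏ i ∈ range N, (1 - x ^ (8 * i + 8)) = 1 := by
    intro i j hi hj
    have h := gaussBinom_mul_prod_mul_prod (x ^ 8) i j
    simp only [← pow_mul, mul_add, mul_one] at h
    rw [hprod 8 i hi, hprod 8 j hj, hprod 8 (i + j) (by omega)] at h
    exact hu.mul_right_cancel (by rw [h, one_mul])
  have h := finite_triple_product x (2 * N)
  have hs : range N ⊆ range (2 * N) := range_subset_range.2 (by omega)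
  rw [prod_mul_distrib, hprod 3 _ (by omega), hprod 5 _ (by omega),
    ← sum_subset (hs.trans (range_subset_range.2 (Nat.le_succ _))) fun r _ hr ↦ ?_,
    ← sum_subset hs fun r _ hr ↦ ?_, ← sum_sub_distrib] at h
  · rw [h, sum_mul]
    refine sum_congr rfl fun r hr ↦ ?_
    have hr := mem_range.1 hr
    have h1 := hg (2 * N - r) (2 * N + r) (by omega) (by omega)
    have h2 := hg (2 * N + 1 + r) (2 * N - (1 + r)) (by omega) (by omega)
    rw [show 2 * N - r + (2 * N + r) = 2 * (2 * N) by omega] at h1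
    rw [show 2 * N + 1 + r + (2 * N - (1 + r)) = 2 * (2 * N) by omega] at h2
    linear_combination (-(-1) ^ r * x ^ (4 * r ^ 2 + r)) * h1 +
      (-1) ^ r * x ^ (4 * r ^ 2 + 7 * r + 3) * h2
  · rw [hx' (4 * r ^ 2 + 7 * r + 3) (by rw [mem_range] at hr; omega), mul_zero]
  · rw [hx' (4 * r ^ 2 + r) (by rw [mem_range] at hr; omega), mul_zero]


theorem product_of_recurrence {x : A} {N : ℕ} (hx : x ^ N = 0) (F : ℕ → A)
    (hF : ∀ k < N, F k = (1 + x ^ (2 * k + 1)) * F (k + 1) + x ^ (2 * k + 2) * F (k + 2))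
    (hF1 : ∀ k, N ≤ k → F k = 1) :
    F 0 * ∏ i ∈ range N, ((1 - x ^ (8 * i + 1)) * (1 - x ^ (8 * i + 4)) * (1 - x ^ (8 * i + 7))) =
      1 := by
  have hprod : ∀ a b m, a ≠ 0 → N ≤ m →
      ∏ i ∈ range m, (1 - x ^ (a * i + b)) = ∏ i ∈ range N, (1 - x ^ (a * i + b)) := by
    intro a b m ha hm
    simpa only [neg_one_mul, ← sub_eq_add_neg] using prod_eq_of_pow_eq_zero hx (-1)
      (fun i ↦ a * i + b) (fun i ↦ le_add_right (Nat.le_mul_of_pos_left i (by omega))) hm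
  have hsplit : ∀ (f : ℕ → A) m, ∏ i ∈ range (2 * m), f i =
      (∏ i ∈ range m, f (2 * i)) * ∏ i ∈ range m, f (2 * i + 1) := fun f m ↦ by
    induction m with
    | zero => simp
    | succ m ih => rw [mul_add_one]; simp only [prod_range_succ, ih]; ring
  have hres : ∀ a b m, ∏ i ∈ range (2 * m), (1 - x ^ (a * i + b)) =
      (∏ i ∈ range m, (1 - x ^ (2 * a * i + b))) *
        ∏ i ∈ range m, (1 - x ^ (2 * a * i + (a + b))) := fun a b m ↦ by
    rw [hsplit]
    congr 1 <;> exact prod_congr rfl fun i _ ↦ by ring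
  have hu : ∀ a b, b ≠ 0 → IsUnit (∏ i ∈ range N, (1 - x ^ (a * i + b))) := fun a b hb ↦
    isUnit_prod_one_sub_pow hx _ _ (by omega)
  have heven : ∏ i ∈ range N, (1 - x ^ (2 * i + 2)) = (∏ i ∈ range N, (1 - x ^ (8 * i + 2))) *
      (∏ i ∈ range N, (1 - x ^ (8 * i + 4))) * (∏ i ∈ range N, (1 - x ^ (8 * i + 6))) *
        ∏ i ∈ range N, (1 - x ^ (8 * i + 8)) := by
    rw [← hprod 2 2 (2 * (2 * N)) (by omega) (by omega), hres, hres, hres]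
    ring
  have hodd : ∏ i ∈ range N, (1 - x ^ (2 * i + 1)) = (∏ i ∈ range N, (1 - x ^ (8 * i + 1))) *
      (∏ i ∈ range N, (1 - x ^ (8 * i + 3))) * (∏ i ∈ range N, (1 - x ^ (8 * i + 5))) *
        ∏ i ∈ range N, (1 - x ^ (8 * i + 7)) := by
    rw [← hprod 2 1 (2 * (2 * N)) (by omega) (by omega), hres, hres, hres]
    ring
  have hsq : (∏ i ∈ range N, (1 + x ^ (2 * i + 1))) * ∏ i ∈ range N, (1 - x ^ (2 * i + 1)) =
      (∏ i ∈ range N, (1 - x ^ (8 * i + 2))) * ∏ i ∈ range N, (1 - x ^ (8 * i + 6)) := by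
    rw [← prod_mul_distrib, prod_congr rfl fun i _ ↦
      (by ring : (1 + x ^ (2 * i + 1)) * (1 - x ^ (2 * i + 1)) = 1 - x ^ (4 * i + 2)),
      ← hprod 4 2 (2 * N) (by omega) (by omega), hres]
  have h := recurrence_mul_prod hx F hF hF1
  rw [triple_product_of_pow_eq_zero hx, heven] at h
  rw [hodd] at hsq
  simp only [prod_mul_distrib]
  have hcancel := (((((hu 8 2 (by omega)).mul (hu 8 6 (by omega))).mul (hu 8 3 (by omega))).mul
    (hu 8 5 (by omega))).mul (hu 8 8 (by omega)))
  refine hcancel.mul_right_cancel ?_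
  generalize ∏ i ∈ range N, (1 - x ^ (8 * i + 1)) = p1 at *
  generalize ∏ i ∈ range N, (1 - x ^ (8 * i + 2)) = p2 at *
  generalize ∏ i ∈ range N, (1 - x ^ (8 * i + 3)) = p3 at *
  generalize ∏ i ∈ range N, (1 - x ^ (8 * i + 4)) = p4 at *
  generalize ∏ i ∈ range N, (1 - x ^ (8 * i + 5)) = p5 at *
  generalize ∏ i ∈ range N, (1 - x ^ (8 * i + 6)) = p6 at *
  generalize ∏ i ∈ range N, (1 - x ^ (8 * i + 7)) = p7 at *
  generalize ∏ i ∈ range N, (1 - x ^ (8 * i + 8)) = p8 at *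
  linear_combination (p1 * p3 * p5 * p7) * h + (p3 * p5 * p8) * hsq

open Classical in
/-- The generating function of the sets of integers in `[2 * k + 1, 2 * L]` that satisfy the
Göllnitz–Gordon gap condition, evaluated at `x`. -/
noncomputable def gapGenFun (x : A) (L k : ℕ) : A :=
  ∑ S ∈ (Icc (2 * k + 1) (2 * L)).powerset with gapCond S.val, x ^ ∑ i ∈ S, i

theorem gapCond_val_iff (S : Finset ℕ) : gapCond S.val ↔
    (∀ a ∈ S, ∀ b ∈ S, a < b → a + 2 ≤ b) ∧
      ∀ a ∈ S, ∀ b ∈ S, Even a → Even b → a < b → a + 4 ≤ b := by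
  simp only [gapCond, mem_val, and_iff_right_iff_imp]
  exact fun _ ↦ Multiset.nodup_iff_count_le_one.1 S.nodup

theorem gapCond_insert_odd {k : ℕ} {S : Finset ℕ} (hS : ∀ a ∈ S, 2 * k + 3 ≤ a) :
    gapCond (insert (2 * k + 1) S).val ↔ gapCond S.val := by
  simp only [gapCond_val_iff]
  grind

theorem gapCond_insert_even {k : ℕ} {S : Finset ℕ} (hS : ∀ a ∈ S, 2 * k + 3 ≤ a) :
    gapCond (insert (2 * k + 2) S).val ↔ gapCond S.val ∧ ∀ a ∈ S, 2 * k + 5 ≤ a := by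
  simp only [gapCond_val_iff]
  constructor
  · rintro ⟨h1, h2⟩
    refine ⟨⟨by grind, by grind⟩, fun a ha ↦ ?_⟩
    have := hS a ha
    have h3 := h1 (2 * k + 2) (by simp) a (by simp [ha]) (by omega)
    have h4 := h2 (2 * k + 2) (by simp) a (by simp [ha]) (by grind)
    grind
  · grind

theorem not_gapCond_insert_insert (k : ℕ) (S : Finset ℕ) :
    ¬ gapCond (insert (2 * k + 1) (insert (2 * k + 2) S)).val := fun h ↦ by
  have := ((gapCond_val_iff _).1 h).1 (2 * k + 1) (by simp) (2 * k + 2) (by simp) (by omega)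
  omega

theorem gapGenFun_recurrence (x : A) {L k : ℕ} (hk : k < L) :
    gapGenFun x L k =
      (1 + x ^ (2 * k + 1)) * gapGenFun x L (k + 1) + x ^ (2 * k + 2) * gapGenFun x L (k + 2) := by
  classical
  have hI : Icc (2 * k + 1) (2 * L) =
      insert (2 * k + 1) (insert (2 * k + 2) (Icc (2 * (k + 1) + 1) (2 * L))) := by
    ext; simp; omega
  have h1 : 2 * k + 1 ∉ insert (2 * k + 2) (Icc (2 * (k + 1) + 1) (2 * L)) := by simp
  have h2 : 2 * k + 2 ∉ Icc (2 * (k + 1) + 1) (2 * L) := by simp; omega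
  have hsub : Icc (2 * (k + 2) + 1) (2 * L) ⊆ Icc (2 * (k + 1) + 1) (2 * L) :=
    Icc_subset_Icc_left (by omega)
  have hmem : ∀ S ∈ (Icc (2 * (k + 1) + 1) (2 * L)).powerset, ∀ a ∈ S, 2 * k + 3 ≤ a :=
    fun S hS a ha ↦ by have := mem_Icc.1 (mem_powerset.1 hS ha); omega
  have e1 : ∀ S ∈ (Icc (2 * (k + 1) + 1) (2 * L)).powerset,
      (if gapCond (insert (2 * k + 1) S).val then x ^ ∑ i ∈ insert (2 * k + 1) S, i else 0) =
        x ^ (2 * k + 1) * if gapCond S.val then x ^ ∑ i ∈ S, i else 0 := fun S hS ↦ by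
    have := hmem S hS
    rw [sum_insert (by grind), pow_add, mul_ite, mul_zero]
    simp only [gapCond_insert_odd this]
  have e2 : ∀ S ∈ (Icc (2 * (k + 1) + 1) (2 * L)).powerset,
      (if gapCond (insert (2 * k + 2) S).val then x ^ ∑ i ∈ insert (2 * k + 2) S, i else 0) =
        x ^ (2 * k + 2) * if S ∈ (Icc (2 * (k + 2) + 1) (2 * L)).powerset then
          if gapCond S.val then x ^ ∑ i ∈ S, i else 0 else 0 := fun S hS ↦ by
    have h := hmem S hS
    have hS' : S ∈ (Icc (2 * (k + 2) + 1) (2 * L)).powerset ↔ ∀ a ∈ S, 2 * k + 5 ≤ a := by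
      rw [mem_powerset, subset_iff] at *
      grind
    rw [sum_insert (by grind), pow_add]
    simp only [gapCond_insert_even h, hS', ite_and, mul_ite, mul_zero]
    split_ifs <;> rfl
  have e3 : ∑ S ∈ (Icc (2 * (k + 1) + 1) (2 * L)).powerset,
      (if S ∈ (Icc (2 * (k + 2) + 1) (2 * L)).powerset then
        if gapCond S.val then x ^ ∑ i ∈ S, i else 0 else 0) =
      ∑ S ∈ (Icc (2 * (k + 2) + 1) (2 * L)).powerset,
        if gapCond S.val then x ^ ∑ i ∈ S, i else 0 := by
    rw [sum_ite_mem, inter_eq_right.2 (powerset_mono.2 hsub)]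
  simp only [gapGenFun, sum_filter]
  rw [hI, sum_powerset_insert h1, sum_powerset_insert h2, sum_powerset_insert h2,
    sum_congr rfl e1, sum_congr rfl e2, ← mul_sum, ← mul_sum, e3]
  simp only [not_gapCond_insert_insert, if_false, sum_const_zero]
  ring

theorem gapGenFun_eq_one (x : A) {L k : ℕ} (hk : L ≤ k) : gapGenFun x L k = 1 := by
  have h : gapCond (∅ : Finset ℕ).val := (gapCond_val_iff ∅).2 (by simp)
  have hI : Icc (2 * k + 1) (2 * L) = ∅ := Icc_eq_empty (by omega)
  rw [gapGenFun, hI, powerset_empty, sum_filter, sum_singleton, if_pos h, sum_empty, pow_zero]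

theorem map_gapGenFun {B : Type*} [CommRing B] (φ : A →+* B) (x : A) (L k : ℕ) :
    φ (gapGenFun x L k) = gapGenFun (φ x) L k := by
  simp [gapGenFun]

theorem coeff_gapGenFun {L n : ℕ} (hn : n ≤ 2 * L) :
    PowerSeries.coeff n (gapGenFun (PowerSeries.X : PowerSeries ℤ) L 0) =
      ({p : n.Partition | gapCond p.parts}.ncard : ℤ) := by
  classical
  rw [Set.ncard_eq_toFinset_card']
  simp only [gapGenFun, map_sum, PowerSeries.coeff_X_pow, sum_boole, filter_filter, Nat.cast_inj]
  symm
  refine card_bij' (fun p _ ↦ p.parts.toFinset)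
    (fun S _ ↦ if h : (0 ∉ S ∧ ∑ i ∈ S, i = n) then
      ⟨S.val, fun {i} hi ↦ Nat.pos_of_ne_zero fun h0 ↦ h.1 (h0 ▸ hi), by
        rw [← h.2]; exact congrArg _ (Multiset.map_id' _).symm⟩ else default) ?_ ?_ ?_ ?_
  · intro p hp
    have hp : gapCond p.parts := by simpa using hp
    have hd : p.parts.dedup = p.parts :=
      Multiset.dedup_eq_self.2 (Multiset.nodup_iff_count_le_one.2 hp.1)
    have hs : ∑ i ∈ p.parts.toFinset, i = n := by
      rw [Finset.sum, Multiset.toFinset_val, hd, Multiset.map_id', p.parts_sum]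
    refine mem_filter.2 ⟨mem_powerset.2 fun a ha ↦ ?_, by rwa [Multiset.toFinset_val, hd], hs.symm⟩
    have ha := Multiset.mem_toFinset.1 ha
    exact mem_Icc.2 ⟨by have := p.parts_pos ha; omega,
      by have := p.le_of_mem_parts ha; omega⟩
  · intro S hS
    obtain ⟨hS, hg, hs⟩ := mem_filter.1 hS
    have h0 : 0 ∉ S := fun h ↦ by simpa using mem_powerset.1 hS h
    simpa [h0, hs.symm] using hg
  · intro p hp
    have hp : gapCond p.parts := by simpa using hp
    have hd : p.parts.dedup = p.parts :=
      Multiset.dedup_eq_self.2 (Multiset.nodup_iff_count_le_one.2 hp.1)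
    have hs : ∑ i ∈ p.parts.toFinset, i = n := by
      rw [Finset.sum, Multiset.toFinset_val, hd, Multiset.map_id', p.parts_sum]
    have h0 : 0 ∉ p.parts := fun h ↦ (p.parts_pos h).ne rfl
    ext1
    simp [h0, hs, hd]
  · intro S hS
    obtain ⟨hS, hg, hs⟩ := mem_filter.1 hS
    have h0 : 0 ∉ S := fun h ↦ by simpa using mem_powerset.1 hS h
    simp [h0, hs.symm]

open scoped PowerSeries.WithPiTopology in
/-- The generating function of the partitions into parts `≡ 1, 4, 7 (mod 8)` is inverse to the
corresponding product, modulo `x ^ N = 0`. -/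
theorem restricted_genFun_mul_prod (N : ℕ) {B : Type*} [CommRing B]
    (φ : PowerSeries ℤ →+* B) (hφ : φ PowerSeries.X ^ N = 0) :
    φ (PowerSeries.mk fun n ↦
        (#(Nat.Partition.restricted n fun a ↦ a % 8 = 1 ∨ a % 8 = 4 ∨ a % 8 = 7) : ℤ)) *
      ∏ i ∈ range N, ((1 - φ .X ^ (8 * i + 1)) * (1 - φ .X ^ (8 * i + 4)) *
        (1 - φ .X ^ (8 * i + 7))) = 1 := by
  let _ : TopologicalSpace ℤ := ⊥
  have _ : DiscreteTopology ℤ := ⟨rfl⟩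
  set p : ℕ → Prop := fun a ↦ a % 8 = 1 ∨ a % 8 = 4 ∨ a % 8 = 7 with hp
  set G : PowerSeries ℤ := PowerSeries.mk fun n ↦ (#(Nat.Partition.restricted n p) : ℤ) with hG
  set f : ℕ → PowerSeries ℤ :=
    fun i ↦ if p (i + 1) then ∑' j : ℕ, .X ^ ((i + 1) * j) else 1 with hf
  set g : ℕ → PowerSeries ℤ := fun i ↦ if p (i + 1) then 1 - .X ^ (i + 1) else 1 with hg
  have hfg : ∀ i, f i * g i = 1 := fun i ↦ by
    simp only [hf, hg]
    split_ifs
    · simp_rw [pow_mul]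
      exact PowerSeries.WithPiTopology.tsum_pow_mul_one_sub_of_constantCoeff_eq_zero (by simp)
    · simp
  have hlim := (Nat.Partition.hasProd_powerSeriesMk_card_restricted ℤ p).tendsto_prod_nat
  rw [PowerSeries.WithPiTopology.tendsto_iff_coeff_tendsto] at hlim
  have hev : ∀ᶠ m in Filter.atTop, 8 * N ≤ m ∧ ∀ d ∈ range N,
      PowerSeries.coeff d (∏ i ∈ range m, f i) = PowerSeries.coeff d G :=
    (Filter.eventually_ge_atTop _).and <| (Filter.eventually_all_finset _).2 fun d _ ↦ by
      have := hlim d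
      rw [nhds_discrete, Filter.tendsto_pure] at this
      exact this
  obtain ⟨m, hm, hmG⟩ := hev.exists
  have hdvd : (PowerSeries.X : PowerSeries ℤ) ^ N ∣ G - ∏ i ∈ range m, f i :=
    PowerSeries.X_pow_dvd_iff.2 fun d hd ↦ by
      rw [map_sub, hmG d (mem_range.2 hd), sub_self]
  have hφG : φ G = φ (∏ i ∈ range m, f i) := by
    obtain ⟨c, hc⟩ := hdvd
    rw [← sub_eq_zero, ← map_sub, hc, map_mul, map_pow, hφ, zero_mul]
  have hgN : ∀ M, ∏ i ∈ range (8 * M), φ (g i) = ∏ i ∈ range M, ((1 - φ .X ^ (8 * i + 1)) *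
      (1 - φ .X ^ (8 * i + 4)) * (1 - φ .X ^ (8 * i + 7))) := fun M ↦ by
    induction M with
    | zero => simp
    | succ M ih =>
      have hmod : ∀ j, (8 * M + j) % 8 = j % 8 := fun j ↦ by omega
      simp only [mul_add_one, prod_range_succ, ih]
      simp only [hg, hp, add_assoc]
      simp [hmod, mul_assoc]
  have hgm : ∏ i ∈ range m, φ (g i) = ∏ i ∈ range (8 * N), φ (g i) := by
    refine (prod_subset (range_subset_range.2 hm) fun i _ hi ↦ ?_).symm
    simp only [hg]
    split_ifs
    · rw [map_sub, map_pow, map_one, pow_eq_zero_of_le (by grind) hφ, sub_zero]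
    · exact map_one φ
  rw [← hgN, ← hgm, hφG, ← map_prod, ← map_mul, ← prod_mul_distrib]
  simp [hfg]

end GoellnitzGordon

/-- First Göllnitz–Gordon identity. -/
theorem goellnitz_gordon_first (n : ℕ) :
    {p : n.Partition | gapCond p.parts}.ncard =
      {p : n.Partition | ∀ a ∈ p.parts, a % 8 = 1 ∨ a % 8 = 4 ∨ a % 8 = 7}.ncard := by
  let φ := Ideal.Quotient.mk (Ideal.span {(PowerSeries.X : PowerSeries ℤ) ^ (n + 1)})
  have hφ : φ PowerSeries.X ^ (n + 1) = 0 := by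
    rw [← map_pow]
    exact Ideal.Quotient.eq_zero_iff_mem.2 (Ideal.mem_span_singleton_self _)
  have h1 := GoellnitzGordon.product_of_recurrence hφ (GoellnitzGordon.gapGenFun (φ .X) (n + 1))
    (fun k hk ↦ GoellnitzGordon.gapGenFun_recurrence _ hk)
    (fun k hk ↦ GoellnitzGordon.gapGenFun_eq_one _ hk)
  have h2 := GoellnitzGordon.restricted_genFun_mul_prod (n + 1) φ hφ
  have h3 := (IsUnit.of_mul_eq_one_right _ h1).mul_right_cancel (h1.trans h2.symm)
  rw [← GoellnitzGordon.map_gapGenFun, Ideal.Quotient.eq, Ideal.mem_span_singleton,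
    PowerSeries.X_pow_dvd_iff] at h3
  have h4 := h3 n n.lt_succ_self
  rw [map_sub, sub_eq_zero, GoellnitzGordon.coeff_gapGenFun (by omega), PowerSeries.coeff_mk] at h4
  rw [Nat.cast_inj.1 h4, ← Set.ncard_coe_finset]
  congr 1
  ext p
  simp [Nat.Partition.restricted]
end

section
/- For every nonnegative integer n, the number of partitions of n with distinct odd parts and smallest even part at least twice the number of parts equals the number of partitions of n into parts congruent to 1, 4, or 7 modulo 8. -/
section GaussianBinomial

variable {R : Type*} [CommRing R]

/-- The Gaussian binomial coefficient, evaluated at an element of a ring. -/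
def gaussBinom (q : R) : ℕ → ℕ → R
  | _, 0 => 1
  | 0, _ + 1 => 0
  | n + 1, k + 1 => gaussBinom q n k + q ^ (k + 1) * gaussBinom q n (k + 1)

/-- The finite `q`-Pochhammer product `(q; q)_n`. -/
def qFactor (q : R) (n : ℕ) : R := ∏ m ∈ Finset.range n, (1 - q ^ (m + 1))

lemma gaussBinom_zero_right (q : R) (n : ℕ) : gaussBinom q n 0 = 1 := by
  cases n <;> rfl

lemma gaussBinom_succ_succ (q : R) (n k : ℕ) :
    gaussBinom q (n + 1) (k + 1) = gaussBinom q n k + q ^ (k + 1) * gaussBinom q n (k + 1) := rfl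

lemma gaussBinom_eq_zero (q : R) : ∀ {n k : ℕ}, n < k → gaussBinom q n k = 0
  | _, 0, h => by omega
  | 0, _ + 1, _ => rfl
  | n + 1, k + 1, h => by
    rw [gaussBinom_succ_succ, gaussBinom_eq_zero q (by omega : n < k),
      gaussBinom_eq_zero q (by omega : n < k + 1)]
    ring

lemma map_gaussBinom {S : Type*} [CommRing S] (f : R →+* S) (q : R) :
    ∀ n k : ℕ, f (gaussBinom q n k) = gaussBinom (f q) n k
  | _, 0 => by simp [gaussBinom_zero_right]
  | 0, _ + 1 => by simp [gaussBinom]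
  | n + 1, k + 1 => by
    simp [gaussBinom_succ_succ, map_gaussBinom f q n k, map_gaussBinom f q n (k + 1)]

lemma qFactor_succ (q : R) (n : ℕ) : qFactor q (n + 1) = qFactor q n * (1 - q ^ (n + 1)) :=
  Finset.prod_range_succ _ _

lemma gaussBinom_mul_qFactor (q : R) (a b : ℕ) :
    gaussBinom q (a + b) a * (qFactor q a * qFactor q b) = qFactor q (a + b) := by
  induction hn : a + b generalizing a b with
  | zero =>
    obtain ⟨rfl, rfl⟩ : a = 0 ∧ b = 0 := by omega
    simp [gaussBinom, qFactor]
  | succ n ih =>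
    rcases a with _ | a
    · obtain rfl : b = n + 1 := by omega
      simp [gaussBinom, qFactor]
    rcases b with _ | b
    · obtain rfl : a = n := by omega
      have h := ih a 0 rfl
      simp only [qFactor, Finset.prod_range_zero, mul_one] at h ⊢
      rw [gaussBinom_succ_succ, gaussBinom_eq_zero q (Nat.lt_succ_self a),
        Finset.prod_range_succ]
      linear_combination (1 - q ^ (a + 1)) * h
    · have h₁ := ih a (b + 1) (by omega)
      have h₂ := ih (a + 1) b (by omega)
      obtain rfl : n = a + b + 1 := by omega
      rw [gaussBinom_succ_succ, qFactor_succ q (a + b + 1)]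
      rw [qFactor_succ] at h₁ h₂ ⊢
      rw [qFactor_succ]
      linear_combination (1 - q ^ (a + 1)) * h₁ + q ^ (a + 1) * (1 - q ^ (b + 1)) * h₂

/-- The finite `q`-binomial theorem, in homogeneous form. -/
lemma prod_add_mul_pow_eq_sum_gaussBinom (p x y : R) (n : ℕ) :
    ∏ m ∈ Finset.range n, (y + x * p ^ (2 * m + 1)) =
      ∑ i ∈ Finset.range (n + 1), p ^ (i ^ 2) * x ^ i * y ^ (n - i) * gaussBinom (p ^ 2) n i := by
  induction n generalizing x with
  | zero => simp [gaussBinom]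
  | succ n ih =>
    rw [Finset.prod_range_succ']
    have h : ∏ m ∈ Finset.range n, (y + x * p ^ (2 * (m + 1) + 1)) =
        ∏ m ∈ Finset.range n, (y + (x * p ^ 2) * p ^ (2 * m + 1)) :=
      Finset.prod_congr rfl fun m _ ↦ by ring
    rw [h, ih, Finset.sum_range_succ' _ (n + 1)]
    have hs : ∑ i ∈ Finset.range (n + 1), p ^ ((i + 1) ^ 2) * x ^ (i + 1) *
          y ^ (n + 1 - (i + 1)) * gaussBinom (p ^ 2) (n + 1) (i + 1) =
        ∑ i ∈ Finset.range (n + 1), p ^ (i ^ 2) * (x * p ^ 2) ^ i * y ^ (n - i) *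
          gaussBinom (p ^ 2) n i * (x * p) +
        ∑ i ∈ Finset.range (n + 1), p ^ ((i + 1) ^ 2) * (x * p ^ 2) ^ (i + 1) * y ^ (n - i) *
          gaussBinom (p ^ 2) n (i + 1) := by
      rw [← Finset.sum_add_distrib]
      refine Finset.sum_congr rfl fun i _ ↦ ?_
      rw [gaussBinom_succ_succ, Nat.add_sub_add_right]
      ring
    have ht : ∑ i ∈ Finset.range (n + 1), p ^ (i ^ 2) * (x * p ^ 2) ^ i * y ^ (n - i) *
          gaussBinom (p ^ 2) n i * y =
        ∑ i ∈ Finset.range (n + 1), p ^ ((i + 1) ^ 2) * (x * p ^ 2) ^ (i + 1) * y ^ (n - i) *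
          gaussBinom (p ^ 2) n (i + 1) + y ^ (n + 1) := by
      rw [Finset.sum_range_succ', Finset.sum_range_succ _ n,
        gaussBinom_eq_zero _ (Nat.lt_succ_self n)]
      simp only [gaussBinom_zero_right, Nat.sub_zero]
      rw [mul_zero, add_zero]
      congr 1
      · refine Finset.sum_congr rfl fun i hi ↦ ?_
        have : n - i = n - (i + 1) + 1 := by have := Finset.mem_range.mp hi; omega
        rw [this]
        ring
      · ring
    rw [hs, mul_add, Finset.sum_mul, Finset.sum_mul, ht]
    simp only [gaussBinom_zero_right]
    simp
    ring

lemma sum_range_two_mul_add_one {A : Type*} [AddCommMonoid A] (f : ℕ → A) (N : ℕ) :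
    ∑ i ∈ Finset.range (2 * N + 1), f i =
      f N + ∑ r ∈ Finset.range N, (f (N + r + 1) + f (N - 1 - r)) := by
  rw [show 2 * N + 1 = N + (N + 1) by ring, Finset.sum_range_add, Finset.sum_range_succ',
    Finset.sum_add_distrib, Finset.sum_range_reflect]
  simp only [add_zero, add_assoc]
  abel

lemma prod_pow_eight_mul_add_four (q : R) (N : ℕ) :
    ∏ m ∈ Finset.range N, q ^ (8 * m + 4) = q ^ (4 * N ^ 2) := by
  induction N with
  | zero => simp
  | succ N ih => rw [Finset.prod_range_succ, ih]; ring

lemma prod_sub_pow_range (q : R) (N : ℕ) :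
    ∏ m ∈ Finset.range N, (q ^ (8 * N + 1) + -1 * (q ^ 4) ^ (2 * m + 1)) =
      (-1) ^ N * q ^ (4 * N ^ 2) * ∏ m ∈ Finset.range N, (1 - q ^ (8 * m + 5)) := by
  rw [← Finset.prod_range_reflect (fun m ↦ 1 - q ^ (8 * m + 5)),
    ← prod_pow_eight_mul_add_four,
    show (-1 : R) ^ N = ∏ m ∈ Finset.range N, (-1 : R) by simp,
    ← Finset.prod_mul_distrib, ← Finset.prod_mul_distrib]
  refine Finset.prod_congr rfl fun m hm ↦ ?_
  obtain ⟨k, rfl⟩ := Nat.exists_eq_add_of_lt (Finset.mem_range.mp hm)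
  rw [show m + k + 1 - 1 - m = k by omega]
  ring

lemma prod_sub_pow_range_add (q : R) (N : ℕ) :
    ∏ m ∈ Finset.range N, (q ^ (8 * N + 1) + -1 * (q ^ 4) ^ (2 * (N + m) + 1)) =
      q ^ (8 * N ^ 2 + N) * ∏ m ∈ Finset.range N, (1 - q ^ (8 * m + 3)) := by
  rw [show q ^ (8 * N ^ 2 + N) = ∏ m ∈ Finset.range N, q ^ (8 * N + 1) by
    rw [Finset.prod_const, Finset.card_range]; ring, ← Finset.prod_mul_distrib]
  exact Finset.prod_congr rfl fun m _ ↦ by ring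

/-- The finite Jacobi triple product at `z = q ^ 3`, `z' = q ^ 5`, up to a power of `q`. -/
lemma pow_mul_finite_triple_product (q : R) (N : ℕ) :
    (-1) ^ N * q ^ (12 * N ^ 2 + N) *
        ∏ m ∈ Finset.range N, ((1 - q ^ (8 * m + 3)) * (1 - q ^ (8 * m + 5))) =
      (-1) ^ N * q ^ (12 * N ^ 2 + N) *
        (gaussBinom (q ^ 8) (2 * N) N + ∑ r ∈ Finset.range N, (-1) ^ (r + 1) *
          (q ^ (4 * r ^ 2 + 7 * r + 3) * gaussBinom (q ^ 8) (2 * N) (N + r + 1) +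
           q ^ (4 * r ^ 2 + 9 * r + 5) * gaussBinom (q ^ 8) (2 * N) (N - 1 - r))) := by
  have key := prod_add_mul_pow_eq_sum_gaussBinom (q ^ 4) (-1) (q ^ (8 * N + 1)) (2 * N)
  rw [sum_range_two_mul_add_one, two_mul, Finset.prod_range_add, prod_sub_pow_range,
    prod_sub_pow_range_add, ← two_mul, ← pow_mul q 4 2] at key
  rw [Finset.prod_mul_distrib]
  trans (-1) ^ N * q ^ (4 * N ^ 2) * (∏ m ∈ Finset.range N, (1 - q ^ (8 * m + 5))) *
      (q ^ (8 * N ^ 2 + N) * ∏ m ∈ Finset.range N, (1 - q ^ (8 * m + 3)))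
  · ring
  rw [key, mul_add, Finset.mul_sum]
  congr 1
  · rw [show 2 * N - N = N by omega]
    ring
  · refine Finset.sum_congr rfl fun r hr ↦ ?_
    obtain ⟨k, rfl⟩ := Nat.exists_eq_add_of_lt (Finset.mem_range.mp hr)
    rw [show 2 * (r + k + 1) - (r + k + 1 + r + 1) = k by omega,
      show r + k + 1 - 1 - r = k by omega, show 2 * (r + k + 1) - k = 2 * r + k + 2 by omega]
    generalize gaussBinom (q ^ (4 * 2)) (2 * (r + k + 1)) (r + k + 1 + r + 1) = G₁
    generalize gaussBinom (q ^ (4 * 2)) (2 * (r + k + 1)) k = G₂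
    have e₁ : (-1 : R) ^ (r + k + 1 + r + 1) = (-1) ^ (r + k + 1) * (-1) ^ (r + 1) := by
      rw [← pow_add, add_assoc (r + k + 1)]
    have e₂ : (-1 : R) ^ k = (-1) ^ (r + k + 1) * (-1) ^ (r + 1) := by
      rw [← pow_add, show r + k + 1 + (r + 1) = k + 2 * (r + 1) by ring, pow_add, pow_mul]
      simp
    rw [e₁, e₂]
    have x₁ : (q ^ 4) ^ ((r + k + 1 + r + 1) ^ 2) * (q ^ (8 * (r + k + 1) + 1)) ^ k =
        q ^ (12 * (r + k + 1) ^ 2 + (r + k + 1)) * q ^ (4 * r ^ 2 + 7 * r + 3) := by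
      rw [← pow_mul, ← pow_mul, ← pow_add, ← pow_add]
      congr 1
      ring
    have x₂ : (q ^ 4) ^ (k ^ 2) * (q ^ (8 * (r + k + 1) + 1)) ^ (2 * r + k + 2) =
        q ^ (12 * (r + k + 1) ^ 2 + (r + k + 1)) * q ^ (4 * r ^ 2 + 9 * r + 5) := by
      rw [← pow_mul, ← pow_mul, ← pow_add, ← pow_add]
      congr 1
      ring
    generalize q ^ (12 * (r + k + 1) ^ 2 + (r + k + 1)) = y at *
    linear_combination (-1) ^ (r + k + 1) * (-1) ^ (r + 1) * (G₁ * x₁ + G₂ * x₂)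

lemma finite_triple_product (q : R) (N : ℕ) :
    ∏ m ∈ Finset.range N, ((1 - q ^ (8 * m + 3)) * (1 - q ^ (8 * m + 5))) =
      gaussBinom (q ^ 8) (2 * N) N + ∑ r ∈ Finset.range N, (-1) ^ (r + 1) *
        (q ^ (4 * r ^ 2 + 7 * r + 3) * gaussBinom (q ^ 8) (2 * N) (N + r + 1) +
         q ^ (4 * r ^ 2 + 9 * r + 5) * gaussBinom (q ^ 8) (2 * N) (N - 1 - r)) := by
  have h := congrArg (Polynomial.eval₂RingHom (Int.castRingHom R) q)
    (mul_left_cancel₀ (by simp) (pow_mul_finite_triple_product (Polynomial.X : Polynomial ℤ) N))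
  have hq : Polynomial.eval₂RingHom (Int.castRingHom R) q Polynomial.X = q := by simp
  simpa only [map_gaussBinom, map_prod, map_sum, map_mul, map_add, map_sub, map_neg, map_one,
    map_pow, hq] using h

end GaussianBinomial

section Nilpotent

open Finset

variable {R : Type*} [CommRing R] {q : R} {M : ℕ}

lemma prod_range_eq_of_eq_one {A : Type*} [CommMonoid A] {f : ℕ → A} {M N : ℕ}
    (hf : ∀ m, M ≤ m → f m = 1) (hN : M ≤ N) : ∏ m ∈ range N, f m = ∏ m ∈ range M, f m := by
  refine (prod_subset (range_mono hN) fun m _ hm ↦ hf m ?_).symm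
  simpa using hm

lemma sum_range_eq_of_eq_zero {A : Type*} [AddCommMonoid A] {f : ℕ → A} {M N : ℕ}
    (hf : ∀ m, M ≤ m → f m = 0) (hN : M ≤ N) : ∑ m ∈ range N, f m = ∑ m ∈ range M, f m := by
  refine (sum_subset (range_mono hN) fun m _ hm ↦ hf m ?_).symm
  simpa using hm

lemma sum_range_eq_zero_add_sum_succ {A : Type*} [AddCommMonoid A] {f : ℕ → A} {M : ℕ}
    (hf : f M = 0) : ∑ m ∈ range M, f m = f 0 + ∑ m ∈ range M, f (m + 1) := by
  rw [add_comm, ← sum_range_succ', sum_range_succ, hf, add_zero]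

lemma prod_range_two_mul {A : Type*} [CommMonoid A] (f : ℕ → A) (N : ℕ) :
    ∏ m ∈ range (2 * N), f m = ∏ m ∈ range N, (f (2 * m) * f (2 * m + 1)) := by
  induction N with
  | zero => simp
  | succ N ih => rw [mul_add, mul_one, prod_range_succ, prod_range_succ, prod_range_succ, ih,
      mul_assoc]

lemma isUnit_one_sub_pow (hq : q ^ M = 0) {k : ℕ} (hk : k ≠ 0) : IsUnit (1 - q ^ k) :=
  (IsNilpotent.pow_of_pos ⟨M, hq⟩ hk).isUnit_one_sub

/-- The coefficients `α_r` of the Bailey pair relative to `q ^ 2` with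
`β_n = 1 / ((q ^ 2; q ^ 2)_n (-q; q ^ 2)_n)`. -/
def baileyAlpha (q : R) : ℕ → R
  | 0 => 1
  | r + 1 => (-1) ^ (r + 1) * q ^ (2 * r ^ 2 + 3 * r + 1) * (1 + q ^ (2 * r + 2))

/-- A special case of the Jacobi triple product identity, for nilpotent `q`. -/
lemma sum_baileyAlpha_mul_pow (hq : q ^ M = 0) :
    ∑ r ∈ range M, baileyAlpha q r * q ^ (2 * r ^ 2) =
      ∏ m ∈ range M, ((1 - q ^ (8 * m + 3)) * (1 - q ^ (8 * m + 5)) * (1 - q ^ (8 * m + 8))) := by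
  have hz {k : ℕ} (hk : M ≤ k) : q ^ k = 0 := pow_eq_zero_of_le hk hq
  have hF {n : ℕ} (hn : M ≤ n) : qFactor (q ^ 8) n = qFactor (q ^ 8) M :=
    prod_range_eq_of_eq_one
      (fun m hm ↦ by rw [← pow_mul, hz (by omega : M ≤ 8 * (m + 1)), sub_zero]) hn
  have hU : IsUnit (qFactor (q ^ 8) M) := by
    refine IsUnit.prod_iff.mpr fun m _ ↦ ?_
    rw [← pow_mul]
    exact isUnit_one_sub_pow hq (by omega)
  have hG {k : ℕ} (h₁ : M ≤ k) (h₂ : k + M ≤ 2 * (2 * M)) :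
      gaussBinom (q ^ 8) (2 * (2 * M)) k * qFactor (q ^ 8) M = 1 := by
    have h := gaussBinom_mul_qFactor (q ^ 8) k (2 * (2 * M) - k)
    rw [show k + (2 * (2 * M) - k) = 2 * (2 * M) by omega, hF h₁,
      hF (by omega : M ≤ 2 * (2 * M) - k), hF (by omega : M ≤ 2 * (2 * M))] at h
    exact hU.mul_right_cancel (by linear_combination h)
  have hfin := finite_triple_product q (2 * M)
  rw [prod_range_eq_of_eq_one (M := M) (fun m hm ↦ by
    rw [hz (by omega : M ≤ 8 * m + 3), hz (by omega : M ≤ 8 * m + 5)]; ring) (by omega)] at hfin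
  have hQ : ∏ m ∈ range M, (1 - q ^ (8 * m + 8)) = qFactor (q ^ 8) M :=
    prod_congr rfl fun m _ ↦ by ring
  rw [prod_mul_distrib, hfin, hQ, add_mul, hG (by omega) (by omega), sum_mul,
    sum_range_eq_zero_add_sum_succ (by rw [hz (by nlinarith), mul_zero]),
    sum_range_eq_of_eq_zero (M := M) (N := 2 * M) _ (by omega)]
  · congr 1
    · simp [baileyAlpha]
    · refine sum_congr rfl fun r hr ↦ ?_
      have hr' := mem_range.mp hr
      have g₁ := hG (by omega : M ≤ 2 * M + r + 1) (by omega)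
      have g₂ := hG (by omega : M ≤ 2 * M - 1 - r) (by omega)
      simp only [baileyAlpha]
      linear_combination -(-1) ^ (r + 1) *
        (q ^ (4 * r ^ 2 + 7 * r + 3) * g₁ + q ^ (4 * r ^ 2 + 9 * r + 5) * g₂)
  · intro m hm
    rw [hz (by nlinarith : M ≤ 4 * m ^ 2 + 7 * m + 3),
      hz (by nlinarith : M ≤ 4 * m ^ 2 + 9 * m + 5)]
    ring

variable {u : ℕ → R}

/-- Euler's identity, as a functional equation. -/
lemma sum_pow_mul_eq_one_add_mul (hq : q ^ M = 0)
    (hu : ∀ n, u n = (1 - q ^ (2 * n + 2)) * u (n + 1)) (j : ℕ) :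
    ∑ i ∈ range M, q ^ (i ^ 2 + 2 * i * j) * u i =
      (1 + q ^ (2 * j + 1)) * ∑ i ∈ range M, q ^ (i ^ 2 + 2 * i * (j + 1)) * u i := by
  rw [← sub_eq_zero, one_add_mul, ← sub_sub, ← sum_sub_distrib, mul_sum,
    sum_range_eq_zero_add_sum_succ]
  · rw [add_sub_assoc, ← sum_sub_distrib, sum_eq_zero fun i _ ↦ ?_]
    · simp
    · rw [hu i]
      ring
  · rw [pow_eq_zero_of_le (by nlinarith : M ≤ M ^ 2 + 2 * M * j) hq,
      pow_eq_zero_of_le (by nlinarith : M ≤ M ^ 2 + 2 * M * (j + 1)) hq]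
    ring

lemma prod_mul_sum_pow_mul (hq : q ^ M = 0)
    (hu : ∀ n, u n = (1 - q ^ (2 * n + 2)) * u (n + 1)) (j : ℕ) :
    (∏ m ∈ range j, (1 + q ^ (2 * m + 1))) * ∑ i ∈ range M, q ^ (i ^ 2 + 2 * i * j) * u i =
      ∑ i ∈ range M, q ^ (i ^ 2) * u i := by
  induction j with
  | zero => simp
  | succ j ih => rw [prod_range_succ, mul_assoc, ← sum_pow_mul_eq_one_add_mul hq hu, ih]

lemma sum_pow_sq_mul (hM : 0 < M) (hq : q ^ M = 0) (h0 : u 0 = 1)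
    (hu : ∀ n, u n = (1 - q ^ (2 * n + 2)) * u (n + 1)) :
    ∑ i ∈ range M, q ^ (i ^ 2) * u i = ∏ m ∈ range M, (1 + q ^ (2 * m + 1)) := by
  rw [← prod_mul_sum_pow_mul hq hu M, sum_eq_single_of_mem 0 (mem_range.mpr hM)]
  · simp [h0]
  · intro i _ hi
    have : 0 < i := Nat.pos_of_ne_zero hi
    rw [pow_eq_zero_of_le (by nlinarith : M ≤ i ^ 2 + 2 * i * M) hq, zero_mul]

/-- Cauchy's Durfee rectangle identity. -/
lemma sum_durfee (hM : 0 < M) (hq : q ^ M = 0) (h0 : u 0 = 1)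
    (hu : ∀ n, u n = (1 - q ^ (2 * n + 2)) * u (n + 1)) (s : ℕ) :
    ∑ m ∈ range M, q ^ (2 * (m ^ 2 + s * m)) * u m * u (m + s) = u M := by
  set D : ℕ → R := fun s ↦ ∑ m ∈ range M, q ^ (2 * (m ^ 2 + s * m)) * u m * u (m + s) with hD
  have step (s : ℕ) : D s - D (s + 1) = q ^ (2 * s + 2) * (D (s + 2) - D (s + 1)) := by
    have h₁ : D s - D (s + 1) =
        ∑ m ∈ range M, q ^ (2 * (m ^ 2 + s * m)) * (1 - q ^ (2 * m)) * u m * u (m + s + 1) -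
        ∑ m ∈ range M, q ^ (2 * s + 2) * (q ^ (2 * (m ^ 2 + (s + 1) * m)) * u m *
          u (m + (s + 1))) := by
      rw [hD, ← sum_sub_distrib, ← sum_sub_distrib]
      refine sum_congr rfl fun m _ ↦ ?_
      rw [hu (m + s), ← add_assoc m s 1]
      ring
    rw [h₁, sum_range_eq_zero_add_sum_succ]
    · simp only [hD, mul_sub (q ^ (2 * s + 2)), mul_sum]
      congr 1
      rw [mul_zero 2, pow_zero, sub_self, mul_zero, zero_mul, zero_mul, zero_add]
      refine sum_congr rfl fun m _ ↦ ?_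
      rw [hu m, show m + 1 + s + 1 = m + (s + 2) by ring]
      ring
    · rw [pow_eq_zero_of_le (by nlinarith : M ≤ 2 * (M ^ 2 + s * M)) hq]
      ring
  have hdvd (k : ℕ) : ∀ s, q ^ k ∣ D s - D (s + 1) := by
    induction k with
    | zero => simp
    | succ k ih =>
      intro s
      rw [step, pow_succ', ← neg_sub (D (s + 1))]
      exact mul_dvd_mul (dvd_pow_self q (by omega)) ((dvd_neg).mpr (ih _))
  have hconst (s : ℕ) : D s = D 0 := by
    induction s with
    | zero => rfl
    | succ s ih =>
      have h := hdvd M s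
      rw [hq, zero_dvd_iff, sub_eq_zero] at h
      rw [← h, ih]
  change D s = u M
  rw [hconst s, ← hconst M, hD]
  dsimp only
  rw [sum_eq_single_of_mem 0 (mem_range.mpr hM)]
  · simp [h0]
  · intro m _ hm
    have : 0 < m := Nat.pos_of_ne_zero hm
    rw [pow_eq_zero_of_le (by nlinarith : M ≤ 2 * (m ^ 2 + M * m)) hq]
    ring

/-- The `β_n` of the Bailey pair with `α_r = baileyAlpha q r`. -/
def baileyBeta (q : R) (u : ℕ → R) (n : ℕ) : R :=
  ∑ r ∈ range (n + 1), baileyAlpha q r * u (n - r) * u (n + r)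

lemma sum_range_baileyAlpha_telescope
    (hu : ∀ n, u n = (1 - q ^ (2 * n + 2)) * u (n + 1)) (k t : ℕ) :
    ∑ r ∈ range (k + 1), baileyAlpha q r *
      ((1 - q ^ (2 * (k + t) + 2)) * (1 + q ^ (2 * (k + t) + 1)) *
        (u (k + t + 1 - r) * u (k + t + 1 + r)) - u (k + t - r) * u (k + t + r)) =
    (-1) ^ k * q ^ (2 * k ^ 2 + 3 * k + 2 * t + 1) * (1 + q ^ (2 * k + 1)) *
      (u t * u (2 * k + 1 + t)) := by
  induction k generalizing t with
  | zero =>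
    simp only [zero_add, sum_range_one, baileyAlpha, Nat.sub_zero, add_zero, mul_zero]
    rw [show 1 + t = t + 1 by ring, hu t]
    ring
  | succ k ih =>
    have h := ih (t + 1)
    rw [show k + (t + 1) = k + 1 + t by ring] at h
    rw [sum_range_succ, h, show k + 1 + t + 1 - (k + 1) = t + 1 by omega,
      show k + 1 + t - (k + 1) = t by omega, show k + 1 + t + 1 + (k + 1) = 2 * k + t + 3 by ring,
      show k + 1 + t + (k + 1) = 2 * k + t + 2 by ring,
      show 2 * (k + 1) + 1 + t = 2 * k + t + 3 by ring,
      show 2 * k + 1 + (t + 1) = 2 * k + t + 2 by ring, hu t, hu (2 * k + t + 2)]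
    simp only [baileyAlpha]
    ring

lemma baileyBeta_succ (h0 : u 0 = 1)
    (hu : ∀ n, u n = (1 - q ^ (2 * n + 2)) * u (n + 1)) (n : ℕ) :
    (1 - q ^ (2 * n + 2)) * (1 + q ^ (2 * n + 1)) * baileyBeta q u (n + 1) = baileyBeta q u n := by
  have h := sum_range_baileyAlpha_telescope hu n 0
  simp only [mul_sub, sum_sub_distrib, add_zero] at h
  have e : ∑ r ∈ range (n + 1), baileyAlpha q r * ((1 - q ^ (2 * n + 2)) *
      (1 + q ^ (2 * n + 1)) * (u (n + 1 - r) * u (n + 1 + r))) =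
      (1 - q ^ (2 * n + 2)) * (1 + q ^ (2 * n + 1)) *
        ∑ r ∈ range (n + 1), baileyAlpha q r * u (n + 1 - r) * u (n + 1 + r) := by
    rw [mul_sum]
    exact sum_congr rfl fun r _ ↦ by ring
  rw [e] at h
  simp only [← mul_assoc (baileyAlpha q _)] at h
  rw [baileyBeta, baileyBeta, sum_range_succ, Nat.sub_self, baileyAlpha,
    show n + 1 + (n + 1) = 2 * n + 1 + 1 by ring]
  rw [h0, hu (2 * n + 1)] at h
  rw [h0]
  linear_combination h

lemma eq_prod_mul_baileyBeta (hq : q ^ M = 0) (h0 : u 0 = 1)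
    (hu : ∀ n, u n = (1 - q ^ (2 * n + 2)) * u (n + 1)) (n : ℕ) :
    u n = (∏ m ∈ range n, (1 + q ^ (2 * m + 1))) * baileyBeta q u n := by
  induction n with
  | zero => simp [baileyBeta, baileyAlpha, h0]
  | succ n ih =>
    apply (isUnit_one_sub_pow hq (by omega : 2 * n + 2 ≠ 0)).mul_left_cancel
    rw [← hu, ih, ← baileyBeta_succ h0 hu, prod_range_succ]
    ring

/-- The limiting case of Bailey's lemma. -/
lemma sum_pow_mul_baileyBeta (hM : 0 < M) (hq : q ^ M = 0) (h0 : u 0 = 1)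
    (hu : ∀ n, u n = (1 - q ^ (2 * n + 2)) * u (n + 1)) :
    ∑ j ∈ range M, q ^ (2 * j ^ 2) * baileyBeta q u j =
      u M * ∑ r ∈ range M, baileyAlpha q r * q ^ (2 * r ^ 2) := by
  simp only [baileyBeta, mul_sum]
  rw [sum_comm' (t' := range M) (s' := fun r ↦ Ico r M) (by simp; omega)]
  refine sum_congr rfl fun r hr ↦ ?_
  rw [sum_Ico_eq_sum_range, ← sum_durfee hM hq h0 hu (2 * r), sum_mul,
    sum_range_eq_of_eq_zero (N := M) (M := M - r) _ (Nat.sub_le _ _)]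
  · refine sum_congr rfl fun m _ ↦ ?_
    rw [show r + m - r = m by omega, show r + m + r = m + 2 * r by ring]
    ring
  · intro m hm
    rw [show q ^ (2 * (m ^ 2 + 2 * r * m)) * u m * u (m + 2 * r) *
      (baileyAlpha q r * q ^ (2 * r ^ 2)) = q ^ (2 * (m + r) ^ 2) * (u m * u (m + 2 * r) *
        baileyAlpha q r) by ring,
      pow_eq_zero_of_le (by nlinarith [(by omega : M ≤ m + r)] : M ≤ 2 * (m + r) ^ 2) hq, zero_mul]

lemma prod_infinite_rearrange (hq : q ^ M = 0) :
    (∏ m ∈ range M, (1 + q ^ (2 * m + 1))) *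
      (∏ m ∈ range M, ((1 - q ^ (8 * m + 3)) * (1 - q ^ (8 * m + 5)) * (1 - q ^ (8 * m + 8)))) *
      (∏ m ∈ range M, ((1 - q ^ (8 * m + 1)) * (1 - q ^ (8 * m + 4)) * (1 - q ^ (8 * m + 7)))) =
    ∏ m ∈ range M, (1 - q ^ (2 * m + 2)) := by
  have hz {k : ℕ} (hk : M ≤ k) : q ^ k = 0 := pow_eq_zero_of_le hk hq
  rw [← prod_range_eq_of_eq_one (N := 2 * (2 * M)) (M := M) (f := fun m ↦ 1 + q ^ (2 * m + 1))
      (fun m hm ↦ by rw [hz (by omega), add_zero]) (by omega),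
    ← prod_range_eq_of_eq_one (N := 2 * (2 * M)) (M := M) (f := fun m ↦ 1 - q ^ (2 * m + 2))
      (fun m hm ↦ by rw [hz (by omega), sub_zero]) (by omega)]
  have h : ∏ m ∈ range (2 * M), (1 - q ^ (4 * m + 2)) =
      ∏ m ∈ range (2 * (2 * M)), (1 - q ^ (4 * m + 2)) := by
    rw [prod_range_eq_of_eq_one (M := M) (N := 2 * M) _ (by omega),
      prod_range_eq_of_eq_one (M := M) (N := 2 * (2 * M)) _ (by omega)] <;>
    exact fun m hm ↦ by rw [hz (by omega), sub_zero]
  rw [prod_range_two_mul (fun m ↦ 1 - q ^ (2 * m + 2)),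
    prod_mul_distrib (f := fun m ↦ 1 - q ^ (2 * (2 * m) + 2)),
    show ∏ m ∈ range (2 * M), (1 - q ^ (2 * (2 * m) + 2)) =
      ∏ m ∈ range (2 * M), (1 - q ^ (4 * m + 2)) from prod_congr rfl fun m _ ↦ by ring, h]
  simp only [prod_range_two_mul, ← prod_mul_distrib]
  exact prod_congr rfl fun m _ ↦ by ring

/-- The first Göllnitz–Gordon identity, for nilpotent `q` and `u n = 1 / (q ^ 2; q ^ 2)_n`. -/
theorem gollnitz_gordon_first (hM : 0 < M) (hq : q ^ M = 0) (h0 : u 0 = 1)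
    (hu : ∀ n, u n = (1 - q ^ (2 * n + 2)) * u (n + 1)) :
    (∑ i ∈ range M, ∑ j ∈ range M, q ^ (2 * (i + j) * j + i ^ 2) * (u i * u j)) *
      ∏ m ∈ range M, ((1 - q ^ (8 * m + 1)) * (1 - q ^ (8 * m + 4)) * (1 - q ^ (8 * m + 7))) =
    1 := by
  have hsum : ∑ i ∈ range M, ∑ j ∈ range M, q ^ (2 * (i + j) * j + i ^ 2) * (u i * u j) =
      (∏ m ∈ range M, (1 + q ^ (2 * m + 1))) *
        (u M * ∑ r ∈ range M, baileyAlpha q r * q ^ (2 * r ^ 2)) := by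
    rw [← sum_pow_mul_baileyBeta hM hq h0 hu, sum_comm, ← sum_pow_sq_mul hM hq h0 hu, mul_sum]
    refine sum_congr rfl fun j _ ↦ ?_
    rw [← prod_mul_sum_pow_mul hq hu j]
    trans q ^ (2 * j ^ 2) * u j * ∑ i ∈ range M, q ^ (i ^ 2 + 2 * i * j) * u i
    · rw [mul_sum]
      exact sum_congr rfl fun i _ ↦ by ring
    · conv_lhs => rw [eq_prod_mul_baileyBeta hq h0 hu j]
      ring
  have huM (n : ℕ) : u n * ∏ m ∈ range n, (1 - q ^ (2 * m + 2)) = 1 := by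
    induction n with
    | zero => simp [h0]
    | succ n ih =>
      rw [hu n] at ih
      rw [prod_range_succ]
      linear_combination ih
  rw [hsum, sum_baileyAlpha_mul_pow hq]
  refine Eq.trans ?_ (huM M)
  rw [← prod_infinite_rearrange hq]
  ring

end Nilpotent

section MultisetGenFun

open PowerSeries

/-- The generating function of a set of multisets, weighted by their sum. -/
noncomputable def multisetGenFun (S : Set (Multiset ℕ)) : ℤ⟦X⟧ :=
  PowerSeries.mk fun n ↦ (Set.ncard {m ∈ S | m.sum = n} : ℤ)

lemma coeff_multisetGenFun (S : Set (Multiset ℕ)) (n : ℕ) :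
    coeff n (multisetGenFun S) = (Set.ncard {m ∈ S | m.sum = n} : ℤ) :=
  coeff_mk _ _

lemma multisetGenFun_image {S : Set (Multiset ℕ)} {f : Multiset ℕ → Multiset ℕ} {d : ℕ}
    (hf : Function.Injective f) (hs : ∀ m ∈ S, (f m).sum = m.sum + d) :
    multisetGenFun (f '' S) = X ^ d * multisetGenFun S := by
  ext n
  rw [coeff_X_pow_mul', coeff_multisetGenFun]
  split_ifs with hd
  · rw [coeff_multisetGenFun, ← Set.ncard_image_of_injective {m ∈ S | m.sum = n - d} hf]
    congr 2
    ext m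
    constructor
    · rintro ⟨⟨m, hm, rfl⟩, h⟩
      exact ⟨m, ⟨hm, by have := hs m hm; omega⟩, rfl⟩
    · rintro ⟨m, ⟨hm, h⟩, rfl⟩
      exact ⟨⟨m, hm, rfl⟩, by have := hs m hm; omega⟩
  · rw [Nat.cast_eq_zero]
    convert Set.ncard_empty (Multiset ℕ)
    rw [Set.eq_empty_iff_forall_notMem]
    rintro _ ⟨⟨m, hm, rfl⟩, h⟩
    have := hs m hm
    omega

lemma multisetGenFun_union {S T : Set (Multiset ℕ)} (hST : Disjoint S T)
    (hS : ∀ n, {m ∈ S | m.sum = n}.Finite) (hT : ∀ n, {m ∈ T | m.sum = n}.Finite) :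
    multisetGenFun (S ∪ T) = multisetGenFun S + multisetGenFun T := by
  ext n
  rw [map_add, coeff_multisetGenFun, coeff_multisetGenFun, coeff_multisetGenFun, ← Nat.cast_add,
    ← Set.ncard_union_eq _ (hS n) (hT n)]
  · congr 2
    ext m
    simp only [Set.mem_ofPred_eq, Set.mem_union]
    tauto
  · exact hST.mono (fun _ h ↦ h.1) fun _ h ↦ h.1

/-- Multisets with `i` odd elements, pairwise distinct, and `j` even elements. -/
def parityClass (i j : ℕ) : Set (Multiset ℕ) :=
  {m | distinctOddParts m ∧ oddCount m = i ∧ evenCount m = j}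

lemma distinctOddParts_iff (m : Multiset ℕ) :
    distinctOddParts m ↔ (m.filter (fun a ↦ Odd a)).Nodup := by
  rw [Multiset.nodup_iff_count_le_one]
  refine forall_congr' fun a ↦ ?_
  rw [Multiset.count_filter]
  split_ifs with h <;> simp [h]

lemma oddCount_add_evenCount (m : Multiset ℕ) : oddCount m + evenCount m = m.card := by
  rw [oddCount, evenCount, ← Multiset.card_add]
  simp only [← Nat.not_odd_iff_even]
  rw [Multiset.filter_add_not]

lemma filter_odd_map {f : ℕ → ℕ} (hp : ∀ a, Odd (f a) ↔ Odd a) (m : Multiset ℕ) :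
    (m.map f).filter (fun a ↦ Odd a) = (m.filter (fun a ↦ Odd a)).map f := by
  rw [Multiset.filter_map]
  exact congrArg _ (Multiset.filter_congr fun a _ ↦ hp a)

lemma evenCount_map {f : ℕ → ℕ} (hp : ∀ a, Odd (f a) ↔ Odd a) (m : Multiset ℕ) :
    evenCount (m.map f) = evenCount m := by
  rw [evenCount, evenCount, Multiset.filter_map, Multiset.card_map]
  refine congrArg _ (Multiset.filter_congr fun a _ ↦ ?_)
  simp [← Nat.not_odd_iff_even, hp]

lemma map_mem_parityClass {f : ℕ → ℕ} (hf : Function.Injective f) (hp : ∀ a, Odd (f a) ↔ Odd a)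
    {i j : ℕ} {m : Multiset ℕ} : m.map f ∈ parityClass i j ↔ m ∈ parityClass i j := by
  simp only [parityClass, Set.mem_ofPred_eq, distinctOddParts_iff, evenCount_map hp, oddCount,
    filter_odd_map hp, Multiset.card_map, Multiset.nodup_map_iff_of_injective hf]

lemma map_image_parityClass {f : ℕ → ℕ} (hf : Function.Injective f)
    (hp : ∀ a, Odd (f a) ↔ Odd a) (i j : ℕ) :
    Multiset.map f '' parityClass i j = {m ∈ parityClass i j | ∀ a ∈ m, a ∈ Set.range f} := by
  ext m
  constructor
  · rintro ⟨m, hm, rfl⟩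
    refine ⟨(map_mem_parityClass hf hp).mpr hm, fun a ha ↦ ?_⟩
    obtain ⟨b, -, rfl⟩ := Multiset.mem_map.mp ha
    exact ⟨b, rfl⟩
  · rintro ⟨hm, h⟩
    have : CanLift ℕ ℕ f (· ∈ Set.range f) := ⟨fun _ h ↦ h⟩
    obtain ⟨m', rfl⟩ := (Multiset.canLift f (· ∈ Set.range f)).prf m h
    exact ⟨m', (map_mem_parityClass hf hp).mp hm, rfl⟩

lemma finite_parityClass_sum (i j n : ℕ) : {m ∈ parityClass i j | m.sum = n}.Finite := by
  refine (Set.finite_Iic ((i + j) • Multiset.range (n + 1))).subset ?_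
  rintro m ⟨⟨-, hi, hj⟩, hn⟩
  rw [Set.mem_Iic, Multiset.le_iff_count]
  intro a
  by_cases ha : a ∈ m
  · have hle : a ≤ n := hn ▸ Multiset.le_sum_of_mem ha
    rw [Multiset.count_nsmul, Multiset.count_eq_one_of_mem (Multiset.nodup_range _)
      (Multiset.mem_range.mpr (by omega)), mul_one, ← hi, ← hj, oddCount_add_evenCount]
    exact Multiset.count_le_card _ _
  · simp [Multiset.count_eq_zero_of_notMem ha]

/-- Adds `d` to the even numbers. -/
def shiftEven (d a : ℕ) : ℕ := if Even a then a + d else a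

/-- Adds `d` to the odd numbers. -/
def shiftOdd (d a : ℕ) : ℕ := if Odd a then a + d else a

lemma odd_shiftEven {d : ℕ} (hd : Even d) (a : ℕ) : Odd (shiftEven d a) ↔ Odd a := by
  unfold shiftEven; grind

lemma odd_shiftOdd {d : ℕ} (hd : Even d) (a : ℕ) : Odd (shiftOdd d a) ↔ Odd a := by
  unfold shiftOdd; grind

lemma shiftEven_injective {d : ℕ} (hd : Even d) : Function.Injective (shiftEven d) := by
  intro a b h
  unfold shiftEven at h
  grind

lemma shiftOdd_injective {d : ℕ} (hd : Even d) : Function.Injective (shiftOdd d) := by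
  intro a b h
  unfold shiftOdd at h
  grind

lemma mem_range_shiftEven {d : ℕ} (hd : Even d) (a : ℕ) :
    a ∈ Set.range (shiftEven d) ↔ (Even a → d ≤ a) := by
  constructor
  · rintro ⟨b, rfl⟩
    unfold shiftEven
    grind
  · intro h
    by_cases ha : Even a
    · exact ⟨a - d, by unfold shiftEven; grind⟩
    · exact ⟨a, by simp [shiftEven, ha]⟩

lemma mem_range_shiftOdd {d : ℕ} (hd : Even d) (a : ℕ) :
    a ∈ Set.range (shiftOdd d) ↔ (Odd a → d ≤ a) := by
  constructor
  · rintro ⟨b, rfl⟩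
    unfold shiftOdd
    grind
  · intro h
    by_cases ha : Odd a
    · exact ⟨a - d, by unfold shiftOdd; grind⟩
    · exact ⟨a, by simp [shiftOdd, ha]⟩

lemma sum_map_shiftEven (d : ℕ) (m : Multiset ℕ) :
    (m.map (shiftEven d)).sum = m.sum + d * evenCount m := by
  induction m using Multiset.induction_on with
  | empty => simp [evenCount]
  | cons a m ih =>
    simp only [Multiset.map_cons, Multiset.sum_cons, ih, evenCount, shiftEven] at *
    by_cases ha : Even a <;> simp [ha] <;> ring

lemma sum_map_shiftOdd (d : ℕ) (m : Multiset ℕ) :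
    (m.map (shiftOdd d)).sum = m.sum + d * oddCount m := by
  induction m using Multiset.induction_on with
  | empty => simp [oddCount]
  | cons a m ih =>
    simp only [Multiset.map_cons, Multiset.sum_cons, ih, oddCount, shiftOdd] at *
    by_cases ha : Odd a <;> simp [ha] <;> ring

lemma multisetGenFun_map_shiftEven {d : ℕ} (hd : Even d) (i j : ℕ) :
    multisetGenFun {m ∈ parityClass i j | ∀ a ∈ m, Even a → d ≤ a} =
      X ^ (d * j) * multisetGenFun (parityClass i j) := by
  simp only [← mem_range_shiftEven hd]
  rw [← map_image_parityClass (shiftEven_injective hd) (odd_shiftEven hd)]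
  refine multisetGenFun_image (Multiset.map_injective (shiftEven_injective hd)) fun m hm ↦ ?_
  rw [sum_map_shiftEven, hm.2.2]

lemma multisetGenFun_map_shiftOdd {d : ℕ} (hd : Even d) (i j : ℕ) :
    multisetGenFun {m ∈ parityClass i j | ∀ a ∈ m, Odd a → d ≤ a} =
      X ^ (d * i) * multisetGenFun (parityClass i j) := by
  simp only [← mem_range_shiftOdd hd]
  rw [← map_image_parityClass (shiftOdd_injective hd) (odd_shiftOdd hd)]
  refine multisetGenFun_image (Multiset.map_injective (shiftOdd_injective hd)) fun m hm ↦ ?_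
  rw [sum_map_shiftOdd, hm.2.1]

lemma cons_zero_mem_parityClass {i j : ℕ} {m : Multiset ℕ} :
    0 ::ₘ m ∈ parityClass i (j + 1) ↔ m ∈ parityClass i j := by
  simp [parityClass, distinctOddParts_iff, oddCount, evenCount]

lemma cons_one_mem_parityClass {i j : ℕ} {m : Multiset ℕ} :
    1 ::ₘ m ∈ parityClass (i + 1) j ↔
      m ∈ {m ∈ parityClass i j | ∀ a ∈ m, Odd a → 2 ≤ a} := by
  have h : (∀ a ∈ m, Odd a → 2 ≤ a) ↔ 1 ∉ m := by
    refine ⟨fun h h1 ↦ by simpa using h 1 h1, fun h a ha ho ↦ ?_⟩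
    have : a ≠ 1 := fun h1 ↦ h (h1 ▸ ha)
    have := ho.pos
    omega
  simp [parityClass, distinctOddParts_iff, oddCount, evenCount, h]
  tauto

lemma multisetGenFun_parityClass_succ_right (i j : ℕ) :
    multisetGenFun (parityClass i j) =
      (1 - X ^ (2 * j + 2)) * multisetGenFun (parityClass i (j + 1)) := by
  have hu : parityClass i (j + 1) = (Multiset.cons 0 '' parityClass i j) ∪
      {m ∈ parityClass i (j + 1) | ∀ a ∈ m, Even a → 2 ≤ a} := by
    ext m
    constructor
    · intro hm
      by_cases h0 : 0 ∈ m
      · obtain ⟨m, rfl⟩ := Multiset.exists_cons_of_mem h0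
        exact Or.inl ⟨m, cons_zero_mem_parityClass.mp hm, rfl⟩
      · refine Or.inr ⟨hm, fun a ha he ↦ ?_⟩
        have : a ≠ 0 := fun h ↦ h0 (h ▸ ha)
        obtain ⟨b, rfl⟩ := he
        omega
    · rintro (⟨m, hm, rfl⟩ | hm)
      · exact cons_zero_mem_parityClass.mpr hm
      · exact hm.1
  have h := congrArg multisetGenFun hu
  rw [multisetGenFun_union, multisetGenFun_map_shiftEven even_two,
    multisetGenFun_image (d := 0) (fun _ _ ↦ (Multiset.cons_inj_right 0).mp) (by simp)] at h
  · linear_combination -h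
  · rw [Set.disjoint_left]
    rintro _ ⟨m, hm, rfl⟩ h
    simpa using h.2 0 (by simp) (by simp)
  · refine fun n ↦ (finite_parityClass_sum i (j + 1) n).subset ?_
    rintro _ ⟨⟨m, hm, rfl⟩, h⟩
    exact ⟨cons_zero_mem_parityClass.mpr hm, h⟩
  · exact fun n ↦ (finite_parityClass_sum i (j + 1) n).subset fun m h ↦ ⟨h.1.1, h.2⟩

lemma multisetGenFun_parityClass_succ_left (i j : ℕ) :
    (1 - X ^ (2 * i + 2)) * multisetGenFun (parityClass (i + 1) j) =
      X ^ (2 * i + 1) * multisetGenFun (parityClass i j) := by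
  have hu : parityClass (i + 1) j =
      (Multiset.cons 1 '' {m ∈ parityClass i j | ∀ a ∈ m, Odd a → 2 ≤ a}) ∪
      {m ∈ parityClass (i + 1) j | ∀ a ∈ m, Odd a → 2 ≤ a} := by
    ext m
    constructor
    · intro hm
      by_cases h0 : 1 ∈ m
      · obtain ⟨m, rfl⟩ := Multiset.exists_cons_of_mem h0
        exact Or.inl ⟨m, cons_one_mem_parityClass.mp hm, rfl⟩
      · refine Or.inr ⟨hm, fun a ha ho ↦ ?_⟩
        have : a ≠ 1 := fun h ↦ h0 (h ▸ ha)
        obtain ⟨b, rfl⟩ := ho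
        omega
    · rintro (⟨m, hm, rfl⟩ | hm)
      · exact cons_one_mem_parityClass.mpr hm
      · exact hm.1
  have h := congrArg multisetGenFun hu
  rw [multisetGenFun_union, multisetGenFun_map_shiftOdd even_two,
    multisetGenFun_image (d := 1) (fun _ _ ↦ (Multiset.cons_inj_right 1).mp) (by simp [add_comm]),
    multisetGenFun_map_shiftOdd even_two] at h
  · linear_combination h
  · rw [Set.disjoint_left]
    rintro _ ⟨m, hm, rfl⟩ h
    simpa using h.2 1 (by simp) (by simp)
  · refine fun n ↦ (finite_parityClass_sum (i + 1) j n).subset ?_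
    rintro _ ⟨⟨m, hm, rfl⟩, h⟩
    exact ⟨cons_one_mem_parityClass.mpr hm, h⟩
  · exact fun n ↦ (finite_parityClass_sum (i + 1) j n).subset fun m h ↦ ⟨h.1.1, h.2⟩

lemma multisetGenFun_parityClass_zero : multisetGenFun (parityClass 0 0) = 1 := by
  have h : parityClass 0 0 = {0} := by
    ext m
    constructor
    · rintro ⟨-, hi, hj⟩
      have := oddCount_add_evenCount m
      rw [hi, hj] at this
      exact Multiset.card_eq_zero.mp this.symm
    · rintro rfl
      simp [parityClass, distinctOddParts, oddCount, evenCount]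
  ext n
  rw [coeff_multisetGenFun, coeff_one, h]
  split_ifs with hn
  · subst hn
    have : {m ∈ ({0} : Set (Multiset ℕ)) | m.sum = 0} = {0} := by
      ext m; simp +contextual
    rw [this, Set.ncard_singleton, Nat.cast_one]
  · rw [Nat.cast_eq_zero]
    convert Set.ncard_empty (Multiset ℕ)
    ext m
    simp only [Set.mem_ofPred_eq, Set.mem_singleton_iff, Set.mem_empty_iff_false, iff_false]
    rintro ⟨rfl, h⟩
    exact hn (by simpa using h.symm)

lemma one_sub_X_pow_ne_zero {k : ℕ} (hk : k ≠ 0) : (1 - X ^ k : ℤ⟦X⟧) ≠ 0 := fun h ↦ by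
  simpa [hk] using congrArg constantCoeff h

lemma multisetGenFun_parityClass (i j : ℕ) :
    multisetGenFun (parityClass i j) = X ^ (i ^ 2) *
      (multisetGenFun (parityClass 0 i) * multisetGenFun (parityClass 0 j)) := by
  induction i with
  | zero => simp [multisetGenFun_parityClass_zero]
  | succ i ih =>
    apply mul_left_cancel₀ (one_sub_X_pow_ne_zero (by omega : 2 * i + 2 ≠ 0))
    rw [multisetGenFun_parityClass_succ_left, ih, multisetGenFun_parityClass_succ_right 0 i]
    ring

/-- Multisets of positive integers with distinct odd elements and whose even elements are at least
twice the cardinality. -/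
def companionSet : Set (Multiset ℕ) :=
  {m | (∀ a ∈ m, 0 < a) ∧ distinctOddParts m ∧ minEvenGe m (2 * m.card)}

lemma companionSet_inter_parityClass (i j : ℕ) :
    companionSet ∩ parityClass i j =
      {m ∈ parityClass i j | ∀ a ∈ m, Even a → 2 * (i + j) ≤ a} := by
  ext m
  simp only [companionSet, Set.mem_inter_iff, Set.mem_ofPred_eq, minEvenGe]
  constructor
  · rintro ⟨⟨-, -, h⟩, hm⟩
    rw [← oddCount_add_evenCount, hm.2.1, hm.2.2] at h
    exact ⟨hm, h⟩
  · rintro ⟨hm, h⟩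
    have hc := oddCount_add_evenCount m
    rw [hm.2.1, hm.2.2] at hc
    refine ⟨⟨fun a ha ↦ ?_, hm.1, hc ▸ h⟩, hm⟩
    have := Multiset.card_pos_iff_exists_mem.mpr ⟨a, ha⟩
    rcases Nat.even_or_odd a with he | ho
    · have := h a ha he
      omega
    · exact ho.pos

lemma card_le_sum_of_pos {m : Multiset ℕ} (h : ∀ a ∈ m, 0 < a) : m.card ≤ m.sum := by
  simpa using Multiset.card_nsmul_le_sum (s := m) (a := 1) h

lemma coeff_multisetGenFun_companionSet {M n : ℕ} (hn : n < M) :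
    coeff n (multisetGenFun companionSet) =
      coeff n (∑ i ∈ Finset.range M, ∑ j ∈ Finset.range M,
        multisetGenFun (companionSet ∩ parityClass i j)) := by
  have hmem (m : Multiset ℕ) (hm : m ∈ {m ∈ companionSet | m.sum = n}) :
      (oddCount m, evenCount m) ∈ Finset.range M ×ˢ Finset.range M := by
    have h₁ := card_le_sum_of_pos hm.1.1
    have h₂ := oddCount_add_evenCount m
    have h₃ : m.sum = n := hm.2
    simp only [Finset.mem_product, Finset.mem_range]
    omega
  have hfin : {m ∈ companionSet | m.sum = n}.Finite := by
    refine ((Finset.range M ×ˢ Finset.range M).finite_toSet.biUnion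
      fun x _ ↦ finite_parityClass_sum x.1 x.2 n).subset fun m hm ↦ ?_
    simp only [Set.mem_iUnion]
    exact ⟨_, hmem m hm, ⟨hm.1.2.1, rfl, rfl⟩, hm.2⟩
  rw [coeff_multisetGenFun, Set.ncard_eq_toFinset_card _ hfin,
    Finset.card_eq_sum_card_fiberwise (f := fun m ↦ (oddCount m, evenCount m))
      (t := Finset.range M ×ˢ Finset.range M)
      (fun m hm ↦ hmem m (by simpa using hm)), Finset.sum_product, Nat.cast_sum, map_sum]
  refine Finset.sum_congr rfl fun i _ ↦ ?_
  rw [Nat.cast_sum, map_sum]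
  refine Finset.sum_congr rfl fun j _ ↦ ?_
  rw [coeff_multisetGenFun, ← Set.ncard_coe_finset]
  congr 2
  ext m
  simp only [Finset.coe_filter, Set.Finite.mem_toFinset, Set.mem_ofPred_eq, Set.mem_inter_iff,
    Prod.mk.injEq]
  constructor
  · rintro ⟨⟨h, hs⟩, hi, hj⟩
    exact ⟨⟨h, h.2.1, hi, hj⟩, hs⟩
  · rintro ⟨⟨h, -, hi, hj⟩, hs⟩
    exact ⟨⟨h, hs⟩, hi, hj⟩

lemma ncard_partition_eq_ncard_multiset (n : ℕ) (P : Multiset ℕ → Prop) :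
    {p : n.Partition | P p.parts}.ncard =
      {m ∈ {m : Multiset ℕ | (∀ a ∈ m, 0 < a) ∧ P m} | m.sum = n}.ncard := by
  rw [← Set.ncard_image_of_injective _ (fun p q h ↦ Nat.Partition.ext h :
    Function.Injective (Nat.Partition.parts (n := n)))]
  congr 1
  ext m
  constructor
  · rintro ⟨p, hp, rfl⟩
    exact ⟨⟨fun a ha ↦ p.parts_pos ha, hp⟩, p.parts_sum⟩
  · rintro ⟨⟨hpos, hP⟩, hs⟩
    exact ⟨⟨m, fun {a} ha ↦ hpos a ha, hs⟩, hP, rfl⟩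

end MultisetGenFun

section Product

open PowerSeries Finset
open scoped PowerSeries.WithPiTopology

lemma mk_eq_mk_iff_coeff_eq {M : ℕ} {f g : ℤ⟦X⟧} :
    Ideal.Quotient.mk (Ideal.span {X ^ M}) f = Ideal.Quotient.mk (Ideal.span {X ^ M}) g ↔
      ∀ n < M, coeff n f = coeff n g := by
  rw [Ideal.Quotient.eq, Ideal.mem_span_singleton, X_pow_dvd_iff]
  simp [sub_eq_zero]

lemma mk_restricted_mul_prod (p : ℕ → Prop) [DecidablePred p] {M N : ℕ} (hN : M ≤ N) :
    Ideal.Quotient.mk (Ideal.span {(X : ℤ⟦X⟧) ^ M})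
      ((PowerSeries.mk fun n ↦ (#(Nat.Partition.restricted n p) : ℤ)) *
        ∏ i ∈ range N, if p (i + 1) then 1 - X ^ (i + 1) else 1) = 1 := by
  set φ := Ideal.Quotient.mk (Ideal.span {(X : ℤ⟦X⟧) ^ M})
  set g : ℕ → ℤ⟦X⟧ := fun i ↦ if p (i + 1) then ∑' j : ℕ, X ^ ((i + 1) * j) else 1
  set h : ℕ → ℤ⟦X⟧ := fun i ↦ if p (i + 1) then 1 - X ^ (i + 1) else 1
  have hgh (i : ℕ) : g i * h i = 1 := by
    by_cases hp : p (i + 1)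
    · simp only [g, h, hp, if_true, pow_mul]
      exact WithPiTopology.tsum_pow_mul_one_sub_of_constantCoeff_eq_zero (by simp)
    · simp [g, h, hp]
  have hprod := Nat.Partition.hasProd_powerSeriesMk_card_restricted ℤ p
  rw [HasProd, WithPiTopology.tendsto_iff_coeff_tendsto] at hprod
  have hev : ∀ᶠ s in Filter.atTop, ∀ n ∈ range M, coeff n (∏ i ∈ s, g i) =
      coeff n (PowerSeries.mk fun n ↦ (#(Nat.Partition.restricted n p) : ℤ)) := by
    rw [Filter.eventually_all_finset]
    intro n _
    have := hprod n
    rw [nhds_discrete, Filter.tendsto_pure] at this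
    exact this
  obtain ⟨s, hs, hsN⟩ := (hev.and (Filter.eventually_ge_atTop (range N))).exists
  have hφ : φ (∏ i ∈ s, g i) =
      φ (PowerSeries.mk fun n ↦ (#(Nat.Partition.restricted n p) : ℤ)) :=
    mk_eq_mk_iff_coeff_eq.mpr fun n hn ↦ hs n (mem_range.mpr hn)
  have hφh : φ (∏ i ∈ range N, h i) = φ (∏ i ∈ s, h i) := by
    rw [map_prod, map_prod]
    refine prod_subset hsN fun i _ hi ↦ ?_
    have hX : φ (X ^ (i + 1)) = 0 := by
      rw [Ideal.Quotient.eq_zero_iff_mem, Ideal.mem_span_singleton]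
      exact pow_dvd_pow _ (by simp at hi; omega)
    by_cases hp : p (i + 1) <;> simp only [h, hp, if_true, if_false, map_sub, map_one, hX, sub_zero]
  rw [map_mul, hφh, ← hφ, ← map_mul, ← prod_mul_distrib]
  simp [hgh]

lemma prod_range_eight_mul {A : Type*} [CommRing A] (q : A) (M : ℕ) :
    ∏ i ∈ range (8 * M), (if (i + 1) % 8 = 1 ∨ (i + 1) % 8 = 4 ∨ (i + 1) % 8 = 7
      then 1 - q ^ (i + 1) else 1) =
    ∏ m ∈ range M, ((1 - q ^ (8 * m + 1)) * (1 - q ^ (8 * m + 4)) * (1 - q ^ (8 * m + 7))) := by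
  induction M with
  | zero => simp
  | succ M ih =>
    rw [prod_range_succ, ← ih, mul_add, mul_one]
    simp only [prod_range_succ, add_assoc]
    norm_num [Nat.add_mod]
    ring

end Product

theorem new_companion_first (n : ℕ) :
    {p : n.Partition | distinctOddParts p.parts ∧
        minEvenGe p.parts (2 * Multiset.card p.parts)}.ncard =
      {p : n.Partition | ∀ a ∈ p.parts, a % 8 = 1 ∨ a % 8 = 4 ∨ a % 8 = 7}.ncard := by
  set P : ℕ → Prop := fun a ↦ a % 8 = 1 ∨ a % 8 = 4 ∨ a % 8 = 7 with hP
  set M := n + 1 with hM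
  set φ := Ideal.Quotient.mk (Ideal.span {(PowerSeries.X : PowerSeries ℤ) ^ M}) with hφ
  have hq : φ PowerSeries.X ^ M = 0 := by
    rw [← map_pow, Ideal.Quotient.eq_zero_iff_mem]
    exact Ideal.mem_span_singleton_self _
  have hgg := gollnitz_gordon_first (u := fun j ↦ φ (multisetGenFun (parityClass 0 j)))
    (by omega : 0 < M) hq (by simp [multisetGenFun_parityClass_zero])
    (fun j ↦ by rw [multisetGenFun_parityClass_succ_right]; simp)
  have hcomp : φ (multisetGenFun companionSet) = ∑ i ∈ Finset.range M, ∑ j ∈ Finset.range M,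
      φ PowerSeries.X ^ (2 * (i + j) * j + i ^ 2) * (φ (multisetGenFun (parityClass 0 i)) *
        φ (multisetGenFun (parityClass 0 j))) := by
    rw [hφ, mk_eq_mk_iff_coeff_eq.mpr fun k hk ↦ coeff_multisetGenFun_companionSet hk, ← hφ,
      map_sum]
    refine Finset.sum_congr rfl fun i _ ↦ ?_
    rw [map_sum]
    refine Finset.sum_congr rfl fun j _ ↦ ?_
    rw [companionSet_inter_parityClass, multisetGenFun_map_shiftEven (even_two_mul _),
      multisetGenFun_parityClass]
    simp only [map_mul, map_pow]
    ring
  have hres := mk_restricted_mul_prod P (by omega : M ≤ 8 * M)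
  rw [prod_range_eight_mul, ← hφ, map_mul, map_prod] at hres
  simp only [map_mul, map_sub, map_one, map_pow] at hres
  rw [← hcomp] at hgg
  have heq := mk_eq_mk_iff_coeff_eq.mp
    (left_inv_eq_right_inv hgg ((mul_comm _ _).trans hres)) n (Nat.lt_succ_self n)
  rw [coeff_multisetGenFun, PowerSeries.coeff_mk, Nat.cast_inj] at heq
  rw [ncard_partition_eq_ncard_multiset n fun m ↦ distinctOddParts m ∧ minEvenGe m (2 * m.card)]
  refine heq.trans ?_
  rw [← Set.ncard_coe_finset]
  congr 1
  ext p
  simp [Nat.Partition.restricted, hP]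
end
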